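/- Let x = x̂ ⊗ t_λ ⊗ z_{−∞} ∈ Σ'_ι[λ] with x̂ = (…, x_2, x_1), and set μ := −λ − wt(x̂). Then for every k ≥ 0, S_{w_k}(x*) = ẽ_{i_k}^{x_k} ⋯ ẽ_{i_2}^{x_2} ẽ_{i_1}^{x_1}(x̂*) ⊗ t_μ ⊗ ẽ_{i_k}^{p_k−x_k} ⋯ ẽ_{i_2}^{p_2−x_2} ẽ_{i_1}^{p_1−x_1}(z_{−∞}), and for every k ≤ 0, S_{w_k}(x*) = f̃_{i_{k+1}}^{p_{k+1}} ⋯ f̃_{i_{−1}}^{p_{−1}} f̃_{i_0}^{p_0}(x̂*) ⊗ t_μ ⊗ z_{−∞}. -/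

import Mathlib

open Filter Function

namespace HypCrystal

variable (a1 a2 k1 k2 : ℤ)

/-- `i_k`: 1 if `k` is odd, 2 if `k` is even. -/
def idx (k : ℤ) : ℤ := if k % 2 = 1 then 1 else 2

/-- membership in the index set `I = {1,2}`. -/
def IsI (i : ℤ) : Prop := i = 1 ∨ i = 2

/-- `⟨α_{i_j}, α_{i_k}^∨⟩`. -/
def pairJK (j k : ℤ) : ℤ :=
  if j % 2 = k % 2 then 2 else if k % 2 = 1 then -a1 else -a2

/-- `⟨α_{i_j}, α_i^∨⟩` for `i ∈ {1,2}`. -/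
def pairJI (j i : ℤ) : ℤ :=
  if idx j = i then 2 else if i = 1 then -a1 else -a2

/-- `α_{i_j}` in the `(Λ1, Λ2)`-coordinates. -/
def alphaOf (j : ℤ) : ℤ × ℤ := if j % 2 = 1 then (2, -a2) else (-a1, 2)

/-- `⟨ν, α_i^∨⟩` for a weight `ν` in `(Λ1, Λ2)`-coordinates. -/
def pairW (ν : ℤ × ℤ) (i : ℤ) : ℤ := if i = 1 then ν.1 else ν.2

/-- the sequence `c_j`. -/
def cseq : ℕ → ℤ
  | 0 => 0
  | 1 => 1
  | j + 2 => (if j % 2 = 0 then a1 else a2) * cseq (j + 1) - cseq j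

/-- the sequence `c'_j`. -/
def cseq' : ℕ → ℤ
  | 0 => 0
  | 1 => 1
  | j + 2 => (if j % 2 = 0 then a2 else a1) * cseq' (j + 1) - cseq' j

noncomputable def alphaR : ℝ :=
  ((a1 : ℝ) * a2 + Real.sqrt ((a1 : ℝ) ^ 2 * (a2 : ℝ) ^ 2 - 4 * a1 * a2)) / (2 * a2)

noncomputable def betaR : ℝ :=
  ((a1 : ℝ) * a2 + Real.sqrt ((a1 : ℝ) ^ 2 * (a2 : ℝ) ^ 2 - 4 * a1 * a2)) / (2 * a1)

/-- `γ_k = α` if `k` even, `β` if `k` odd. -/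
noncomputable def gammaR (k : ℤ) : ℝ := if k % 2 = 0 then alphaR a1 a2 else betaR a1 a2

/-- `p_m` for `m ≥ 0`. -/
def ppos : ℕ → ℤ
  | 0 => k2
  | 1 => k1
  | m + 2 => (if m % 2 = 0 then a2 else a1) * ppos (m + 1) - ppos m

/-- `p_{-n}` for `n ≥ 0`. -/
def pneg : ℕ → ℤ
  | 0 => k2
  | 1 => a1 * k2 - k1
  | n + 2 => (if (n + 2) % 2 = 0 then a2 else a1) * pneg (n + 1) - pneg n

/-- the two-sided sequence `p_m`, `m ∈ ℤ`, with `p_0 = k2`, `p_1 = k1`. -/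
def pseq (m : ℤ) : ℤ :=
  if 0 ≤ m then ppos a1 a2 k1 k2 m.toNat else pneg a1 a2 k1 k2 (-m).toNat

/-- `λ = k1·Λ1 − k2·Λ2` in `(Λ1, Λ2)`-coordinates. -/
def lamW : ℤ × ℤ := (k1, -k2)

/-- membership in `ℤ^{+∞}` (coordinates supported on positions `≥ 1`, nonnegative,
finitely supported). -/
def ZPlusMem (x : ℤ → ℤ) : Prop :=
  (∀ k : ℤ, k ≤ 0 → x k = 0) ∧ (∀ k : ℤ, 0 ≤ x k) ∧ ∃ N : ℕ, ∀ k : ℤ, (N : ℤ) < k → x k = 0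

/-- membership in `ℤ^{−∞}` (coordinates supported on positions `≤ 0`, nonpositive,
finitely supported). -/
def ZMinusMem (x : ℤ → ℤ) : Prop :=
  (∀ k : ℤ, 1 ≤ k → x k = 0) ∧ (∀ k : ℤ, x k ≤ 0) ∧ ∃ N : ℕ, ∀ k : ℤ, k < -(N : ℤ) → x k = 0

/-- membership in `X+ = Img(Ψ⁺)`. -/
def XPlusMem (x : ℤ → ℤ) : Prop :=
  ZPlusMem x ∧ ∀ j : ℤ, 1 ≤ j →
    0 ≤ cseq a1 a2 j.toNat * x j - cseq a1 a2 (j - 1).toNat * x (j + 1)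

/-- membership in `X− = Img(Ψ⁻)`. -/
def XMinusMem (x : ℤ → ℤ) : Prop :=
  ZMinusMem x ∧ ∀ j : ℤ, j ≤ 0 →
    cseq' a1 a2 (1 - j).toNat * x j - cseq' a1 a2 (-j).toNat * x (j - 1) ≤ 0

def posPart (x : ℤ → ℤ) : ℤ → ℤ := fun k => if 1 ≤ k then x k else 0
def negPart (x : ℤ → ℤ) : ℤ → ℤ := fun k => if k ≤ 0 then x k else 0

/-- membership in `Z_ι(μ) = ℤ^{+∞} ⊗ t_μ ⊗ ℤ^{−∞}` (in coordinates). -/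
def ZMem (x : ℤ → ℤ) : Prop := ZPlusMem (posPart x) ∧ ZMinusMem (negPart x)

/-- membership in `X+ ⊗ t_λ ⊗ X−` (in coordinates). -/
def XXMem (x : ℤ → ℤ) : Prop := XPlusMem a1 a2 (posPart x) ∧ XMinusMem a1 a2 (negPart x)

/-- `σ_k` on `ℤ^{+∞}` (for `k ≥ 1`). -/
noncomputable def sigmaP (x : ℤ → ℤ) (k : ℤ) : ℤ :=
  x k + ∑ᶠ j : ℤ, if k < j then pairJK a1 a2 j k * x j else 0

/-- `σ_k` on `ℤ^{−∞}` (for `k ≤ 0`). -/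
noncomputable def sigmaM (x : ℤ → ℤ) (k : ℤ) : ℤ :=
  -(x k) - ∑ᶠ j : ℤ, if j < k then pairJK a1 a2 j k * x j else 0

/-- `−Σ_j x_j α_{i_j}` in `(Λ1, Λ2)`-coordinates. -/
noncomputable def wtOf (x : ℤ → ℤ) : ℤ × ℤ :=
  (-∑ᶠ j : ℤ, x j * (alphaOf a1 a2 j).1, -∑ᶠ j : ℤ, x j * (alphaOf a1 a2 j).2)

/-- `wt(x) = μ − Σ_j x_j α_{i_j}`. -/
noncomputable def wtZ (μ : ℤ × ℤ) (x : ℤ → ℤ) : ℤ × ℤ := μ + wtOf a1 a2 x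

/-- `σ_k` on `Z_ι(μ)`. -/
noncomputable def sigmaZ (μ : ℤ × ℤ) (x : ℤ → ℤ) (k : ℤ) : ℤ :=
  if 1 ≤ k then sigmaP a1 a2 x k
  else sigmaM a1 a2 x k - pairW (wtZ a1 a2 μ x) (idx k)

/-- `ε_i` on `Z_ι(μ)`. -/
noncomputable def epsZ (μ : ℤ × ℤ) (x : ℤ → ℤ) (i : ℤ) : ℤ :=
  sSup {s : ℤ | ∃ k : ℤ, idx k = i ∧ sigmaZ a1 a2 μ x k = s}

/-- `φ_i` on `Z_ι(μ)`. -/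
noncomputable def phiZ (μ : ℤ × ℤ) (x : ℤ → ℤ) (i : ℤ) : ℤ :=
  epsZ a1 a2 μ x i + pairW (wtZ a1 a2 μ x) i

noncomputable def kmaxZ (μ : ℤ × ℤ) (x : ℤ → ℤ) (i : ℤ) : ℤ :=
  sSup {k : ℤ | idx k = i ∧ sigmaZ a1 a2 μ x k = epsZ a1 a2 μ x i}

noncomputable def kminZ (μ : ℤ × ℤ) (x : ℤ → ℤ) (i : ℤ) : ℤ :=
  sInf {k : ℤ | idx k = i ∧ sigmaZ a1 a2 μ x k = epsZ a1 a2 μ x i}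

/-- `ẽ_i` on `Z_ι(μ)`; `none` represents `0`. -/
noncomputable def eZ (μ : ℤ × ℤ) (i : ℤ) (x : ℤ → ℤ) : Option (ℤ → ℤ) :=
  if 0 < epsZ a1 a2 μ x i then
    some (Function.update x (kmaxZ a1 a2 μ x i) (x (kmaxZ a1 a2 μ x i) - 1))
  else none

/-- `f̃_i` on `Z_ι(μ)`; `none` represents `0`. -/
noncomputable def fZ (μ : ℤ × ℤ) (i : ℤ) (x : ℤ → ℤ) : Option (ℤ → ℤ) :=
  if 0 < phiZ a1 a2 μ x i then
    some (Function.update x (kminZ a1 a2 μ x i) (x (kminZ a1 a2 μ x i) + 1))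
  else none

/-- `ε_i` on `ℤ^{+∞}`. -/
noncomputable def epsP (x : ℤ → ℤ) (i : ℤ) : ℤ :=
  sSup {s : ℤ | ∃ k : ℤ, 1 ≤ k ∧ idx k = i ∧ sigmaP a1 a2 x k = s}

noncomputable def kmaxP (x : ℤ → ℤ) (i : ℤ) : ℤ :=
  sSup {k : ℤ | 1 ≤ k ∧ idx k = i ∧ sigmaP a1 a2 x k = epsP a1 a2 x i}

noncomputable def kminP (x : ℤ → ℤ) (i : ℤ) : ℤ :=
  sInf {k : ℤ | 1 ≤ k ∧ idx k = i ∧ sigmaP a1 a2 x k = epsP a1 a2 x i}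

/-- `ẽ_i` on `ℤ^{+∞}` (partial). -/
noncomputable def eP (i : ℤ) (x : ℤ → ℤ) : Option (ℤ → ℤ) :=
  if 0 < epsP a1 a2 x i then
    some (Function.update x (kmaxP a1 a2 x i) (x (kmaxP a1 a2 x i) - 1))
  else none

/-- `f̃_i` on `ℤ^{+∞}` (total). -/
noncomputable def fP (i : ℤ) (x : ℤ → ℤ) : ℤ → ℤ :=
  Function.update x (kminP a1 a2 x i) (x (kminP a1 a2 x i) + 1)

/-- `φ_i` on `ℤ^{−∞}`. -/
noncomputable def phiMf (x : ℤ → ℤ) (i : ℤ) : ℤ :=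
  sSup {s : ℤ | ∃ k : ℤ, k ≤ 0 ∧ idx k = i ∧ sigmaM a1 a2 x k = s}

noncomputable def kmaxM (x : ℤ → ℤ) (i : ℤ) : ℤ :=
  sSup {k : ℤ | k ≤ 0 ∧ idx k = i ∧ sigmaM a1 a2 x k = phiMf a1 a2 x i}

noncomputable def kminM (x : ℤ → ℤ) (i : ℤ) : ℤ :=
  sInf {k : ℤ | k ≤ 0 ∧ idx k = i ∧ sigmaM a1 a2 x k = phiMf a1 a2 x i}

/-- `ẽ_i` on `ℤ^{−∞}` (total). -/
noncomputable def eM (i : ℤ) (x : ℤ → ℤ) : ℤ → ℤ :=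
  Function.update x (kmaxM a1 a2 x i) (x (kmaxM a1 a2 x i) - 1)

noncomputable def fPiter (i : ℤ) (n : ℕ) (x : ℤ → ℤ) : ℤ → ℤ := (fP a1 a2 i)^[n] x

noncomputable def eMiter (i : ℤ) (n : ℕ) (x : ℤ → ℤ) : ℤ → ℤ := (eM a1 a2 i)^[n] x

noncomputable def ePiterO (i : ℤ) (n : ℕ) (ox : Option (ℤ → ℤ)) : Option (ℤ → ℤ) :=
  (fun o => o.bind (eP a1 a2 i))^[n] ox

noncomputable def eZiterO (μ : ℤ × ℤ) (i : ℤ) (n : ℕ) (ox : Option (ℤ → ℤ)) : Option (ℤ → ℤ) :=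
  (fun o => o.bind (eZ a1 a2 μ i))^[n] ox

noncomputable def fZiterO (μ : ℤ × ℤ) (i : ℤ) (n : ℕ) (ox : Option (ℤ → ℤ)) : Option (ℤ → ℤ) :=
  (fun o => o.bind (fZ a1 a2 μ i))^[n] ox

noncomputable def suppBoundP (x : ℤ → ℤ) : ℕ := sInf {N : ℕ | ∀ k : ℤ, (N : ℤ) < k → x k = 0}

noncomputable def suppBoundM (x : ℤ → ℤ) : ℕ := sInf {N : ℕ | ∀ k : ℤ, k < -(N : ℤ) → x k = 0}

/-- `starPChain x n z = f̃_{i_1}^{x_1} ⋯ f̃_{i_n}^{x_n} (z)` on `ℤ^{+∞}`. -/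
noncomputable def starPChain (x : ℤ → ℤ) : ℕ → (ℤ → ℤ) → (ℤ → ℤ)
  | 0, z => z
  | n + 1, z => starPChain x n (fPiter a1 a2 (idx ((n : ℤ) + 1)) ((x ((n : ℤ) + 1)).toNat) z)

/-- the `∗`-operation on `X+`: `(x⁺)* = f̃_{i_1}^{x_1} ⋯ f̃_{i_N}^{x_N} (z_∞)`. -/
noncomputable def starP (x : ℤ → ℤ) : ℤ → ℤ :=
  starPChain a1 a2 x (suppBoundP x) (fun _ => 0)

/-- `starMChain x n z = ẽ_{i_0}^{−x_0} ⋯ ẽ_{i_{-(n-1)}}^{−x_{-(n-1)}} (z)` on `ℤ^{−∞}`. -/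
noncomputable def starMChain (x : ℤ → ℤ) : ℕ → (ℤ → ℤ) → (ℤ → ℤ)
  | 0, z => z
  | n + 1, z => starMChain x n (eMiter a1 a2 (idx (-(n : ℤ))) ((-(x (-(n : ℤ)))).toNat) z)

/-- the `∗`-operation on `X−`. -/
noncomputable def starM (x : ℤ → ℤ) : ℤ → ℤ :=
  starMChain a1 a2 x (suppBoundM x + 1) (fun _ => 0)

/-- combine a `ℤ^{+∞}`- and a `ℤ^{−∞}`-component into an element of `Z_ι(μ)`. -/
def combine (y z : ℤ → ℤ) : ℤ → ℤ := fun k => if 1 ≤ k then y k else z k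

/-- the coordinates of `x* = (x⁺)* ⊗ t_μ ⊗ (x⁻)*`. -/
noncomputable def xstarFun (x : ℤ → ℤ) : ℤ → ℤ :=
  combine (starP a1 a2 (posPart x)) (starM a1 a2 (negPart x))

/-- the weight `μ = −λ − wt(x⁺) − wt(x⁻)` of `x*`. -/
noncomputable def mustar (lam : ℤ × ℤ) (x : ℤ → ℤ) : ℤ × ℤ :=
  -lam - wtOf a1 a2 (posPart x) - wtOf a1 a2 (negPart x)

/-- `fPnegChain g n z = f̃_{i_{-(n-1)}}^{g(-(n-1))} ⋯ f̃_{i_{-1}}^{g(-1)} f̃_{i_0}^{g 0} (z)`. -/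
noncomputable def fPnegChain (g : ℤ → ℕ) : ℕ → (ℤ → ℤ) → (ℤ → ℤ)
  | 0, z => z
  | n + 1, z => fPiter a1 a2 (idx (-(n : ℤ))) (g (-(n : ℤ))) (fPnegChain g n z)

/-- `eMposChain g n z = ẽ_{i_n}^{g n} ⋯ ẽ_{i_2}^{g 2} ẽ_{i_1}^{g 1} (z)`. -/
noncomputable def eMposChain (g : ℤ → ℕ) : ℕ → (ℤ → ℤ) → (ℤ → ℤ)
  | 0, z => z
  | n + 1, z => eMiter a1 a2 (idx ((n : ℤ) + 1)) (g ((n : ℤ) + 1)) (eMposChain g n z)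

/-- `ePposChainO g n z = ẽ_{i_n}^{g n} ⋯ ẽ_{i_2}^{g 2} ẽ_{i_1}^{g 1} (z)` on `ℤ^{+∞}`. -/
noncomputable def ePposChainO (g : ℤ → ℕ) : ℕ → Option (ℤ → ℤ) → Option (ℤ → ℤ)
  | 0, z => z
  | n + 1, z => ePiterO a1 a2 (idx ((n : ℤ) + 1)) (g ((n : ℤ) + 1)) (ePposChainO g n z)

/-- the Weyl group action `S_i` on `Z_ι(μ) ∪ {0}`. -/
noncomputable def SiO (μ : ℤ × ℤ) (i : ℤ) (ob : Option (ℤ → ℤ)) : Option (ℤ → ℤ) :=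
  ob.bind fun b =>
    if 0 ≤ pairW (wtZ a1 a2 μ b) i then
      fZiterO a1 a2 μ i (pairW (wtZ a1 a2 μ b) i).toNat (some b)
    else eZiterO a1 a2 μ i (-(pairW (wtZ a1 a2 μ b) i)).toNat (some b)

/-- `SwPos μ n = S_{i_n} ⋯ S_{i_2} S_{i_1}`. -/
noncomputable def SwPos (μ : ℤ × ℤ) : ℕ → Option (ℤ → ℤ) → Option (ℤ → ℤ)
  | 0, b => b
  | n + 1, b => SiO a1 a2 μ (idx ((n : ℤ) + 1)) (SwPos μ n b)

/-- `SwNeg μ n = S_{i_{-(n-1)}} ⋯ S_{i_{-1}} S_{i_0}`. -/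
noncomputable def SwNeg (μ : ℤ × ℤ) : ℕ → Option (ℤ → ℤ) → Option (ℤ → ℤ)
  | 0, b => b
  | n + 1, b => SiO a1 a2 μ (idx (-(n : ℤ))) (SwNeg μ n b)

/-- `S_{w_k}`. -/
noncomputable def Swk (μ : ℤ × ℤ) (k : ℤ) (b : Option (ℤ → ℤ)) : Option (ℤ → ℤ) :=
  if 0 ≤ k then SwPos a1 a2 μ k.toNat b else SwNeg a1 a2 μ (-k).toNat b

/-- `b ∈ Z_ι(μ)` is extremal. -/
noncomputable def Extremal (μ : ℤ × ℤ) (b : ℤ → ℤ) : Prop :=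
  ∀ js : List ℤ, (∀ j ∈ js, IsI j) →
    ∃ b', js.foldr (SiO a1 a2 μ) (some b) = some b' ∧
      ∀ i : ℤ, IsI i →
        (0 ≤ pairW (wtZ a1 a2 μ b') i → eZ a1 a2 μ i b' = none) ∧
        (pairW (wtZ a1 a2 μ b') i ≤ 0 → fZ a1 a2 μ i b' = none)

/-- `φ(x) ≥ 0` for all `φ ∈ Ξ_ι[λ]`. -/
noncomputable def SigmaCond (x : ℤ → ℤ) : Prop :=
  (0 ≤ gammaR a1 a2 0 * (pseq a1 a2 k1 k2 0 : ℝ) + gammaR a1 a2 0 * (x 0 : ℝ) - (x 1 : ℝ)) ∧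
  (0 ≤ gammaR a1 a2 1 * (pseq a1 a2 k1 k2 1 : ℝ) + (x 0 : ℝ) - gammaR a1 a2 1 * (x 1 : ℝ)) ∧
  (∀ k : ℤ, 1 ≤ k → 0 ≤ (pseq a1 a2 k1 k2 k : ℝ) - (x k : ℝ)) ∧
  (∀ k : ℤ, 1 ≤ k → 0 ≤ gammaR a1 a2 k * (x k : ℝ) - (x (k + 1) : ℝ)) ∧
  (∀ k : ℤ, 1 ≤ k → 0 ≤ gammaR a1 a2 (k + 1) * (pseq a1 a2 k1 k2 (k + 1) : ℝ) -
      (pseq a1 a2 k1 k2 k : ℝ) + (x k : ℝ) - gammaR a1 a2 (k + 1) * (x (k + 1) : ℝ)) ∧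
  (∀ k : ℤ, k ≤ 0 → 0 ≤ (pseq a1 a2 k1 k2 k : ℝ) + (x k : ℝ)) ∧
  (∀ k : ℤ, k ≤ 0 → 0 ≤ (x (k - 1) : ℝ) - gammaR a1 a2 k * (x k : ℝ)) ∧
  (∀ k : ℤ, k ≤ 0 → 0 ≤ gammaR a1 a2 (k - 1) * (pseq a1 a2 k1 k2 (k - 1) : ℝ) -
      (pseq a1 a2 k1 k2 k : ℝ) + gammaR a1 a2 (k - 1) * (x (k - 1) : ℝ) - (x k : ℝ))

/-- membership in `Σ_ι[λ]`. -/
noncomputable def SigmaMem (x : ℤ → ℤ) : Prop :=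
  ZMem x ∧ SigmaCond a1 a2 k1 k2 x

/-- membership in `Σ'_ι[λ]`. -/
noncomputable def SigmaPrimeMem (x : ℤ → ℤ) : Prop :=
  SigmaMem a1 a2 k1 k2 x ∧ (∀ k : ℤ, k ≤ 0 → x k = 0) ∧ XPlusMem a1 a2 (posPart x)

/-- evaluation of an affine function `φ = (c, (φ_l)_l)` at `x`. -/
noncomputable def evalAff (φ : ℝ × (ℤ → ℝ)) (x : ℤ → ℤ) : ℝ :=
  φ.1 + ∑ᶠ l : ℤ, φ.2 l * (x l : ℝ)

/-- `a_{i_k}`. -/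
def aIdx (k : ℤ) : ℤ := if k % 2 = 1 then a1 else a2

/-- the affine function `b̄_k`. -/
noncomputable def bbar (lam : ℤ × ℤ) (k : ℤ) : ℝ × (ℤ → ℝ) :=
  ((if k = -1 ∨ k = 0 then -(pairW lam (idx k) : ℝ) else 0),
    fun l => (if l = k then (1 : ℝ) else 0) + (if l = k + 1 then -(aIdx a1 a2 k : ℝ) else 0) +
      (if l = k + 2 then (1 : ℝ) else 0))

/-- the operator `S̄_k` on affine functions. -/
noncomputable def SbarOp (lam : ℤ × ℤ) (k : ℤ) (φ : ℝ × (ℤ → ℝ)) : ℝ × (ℤ → ℝ) :=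
  let b := if 0 ≤ φ.2 k then bbar a1 a2 lam (k + 2) else bbar a1 a2 lam (k - 2)
  (φ.1 - φ.2 k * b.1, fun l => φ.2 l - φ.2 k * b.2 l)

end HypCrystal

namespace HypCrystal

section Crystal

variable {a1 a2 : ℤ} {x y w : ℤ → ℤ}

theorem idx_eq_iff {k l : ℤ} : idx k = idx l ↔ k % 2 = l % 2 := by
  unfold idx
  split_ifs <;> omega

theorem idx_ne_iff {k l : ℤ} : idx k ≠ idx l ↔ k % 2 ≠ l % 2 := idx_eq_iff.not

theorem pairJK_congr {j j' k : ℤ} (h : idx j = idx j') :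
    pairJK a1 a2 j k = pairJK a1 a2 j' k := by
  rw [idx_eq_iff] at h
  simp [pairJK, h]

theorem pairJK_of_idx_eq {j k : ℤ} (h : idx j = idx k) : pairJK a1 a2 j k = 2 := by
  rw [idx_eq_iff] at h
  simp [pairJK, h]

theorem pairJK_of_idx_ne {j k : ℤ} (h : idx j ≠ idx k) : pairJK a1 a2 j k = -aIdx a1 a2 k := by
  rw [idx_ne_iff] at h
  unfold pairJK aIdx
  split_ifs <;> omega

theorem pseq_rec (k1 k2 m : ℤ) :
    pseq a1 a2 k1 k2 (m + 2) =
      aIdx a1 a2 m * pseq a1 a2 k1 k2 (m + 1) - pseq a1 a2 k1 k2 m := by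
  rcases lt_trichotomy m (-1) with h | rfl | h
  · obtain ⟨n, rfl⟩ : ∃ n : ℕ, m = -((n : ℤ) + 2) := ⟨(-m - 2).toNat, by omega⟩
    have h0 : pseq a1 a2 k1 k2 (-((n : ℤ) + 2) + 2) = pneg a1 a2 k1 k2 n := by
      rcases Nat.eq_zero_or_pos n with rfl | hn
      · simp [pseq, pneg, ppos]
      · rw [pseq, if_neg (by omega)]
        congr 1
        omega
    have h1 : pseq a1 a2 k1 k2 (-((n : ℤ) + 2) + 1) = pneg a1 a2 k1 k2 (n + 1) := by
      rw [pseq, if_neg (by omega)]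
      congr 1
    have h2 : pseq a1 a2 k1 k2 (-((n : ℤ) + 2)) = pneg a1 a2 k1 k2 (n + 2) := by
      rw [pseq, if_neg (by omega)]
      congr 1
    rw [h0, h1, h2, pneg, aIdx]
    split_ifs <;> omega
  · simp [pseq, pneg, ppos, aIdx]
  · obtain ⟨n, rfl⟩ : ∃ n : ℕ, m = n := ⟨m.toNat, by omega⟩
    have h0 (l : ℕ) : pseq a1 a2 k1 k2 (l : ℤ) = ppos a1 a2 k1 k2 l := by simp [pseq]
    have h1 : ((n : ℤ) + 1) = ((n + 1 : ℕ) : ℤ) := by push_cast; ring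
    have h2 : ((n : ℤ) + 2) = ((n + 2 : ℕ) : ℤ) := by push_cast; ring
    rw [h1, h2, h0, h0, h0, ppos, aIdx]
    split_ifs <;> omega

/-! ### Changing one coordinate -/

theorem finite_support_update (hx : x.support.Finite) (l v : ℤ) :
    (Function.update x l v).support.Finite := by
  refine (hx.insert l).subset fun j hj => ?_
  by_cases h : j = l
  · exact Or.inl h
  · right
    simpa [Function.update_of_ne h] using hj

theorem finsum_mul_update (hx : x.support.Finite) (c : ℤ → ℤ) (l v : ℤ) :
    ∑ᶠ j : ℤ, c j * Function.update x l (x l + v) j = (∑ᶠ j : ℤ, c j * x j) + c l * v := by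
  have h1 : ∀ j, c j * Function.update x l (x l + v) j =
      c j * x j + if j = l then c l * v else 0 := by
    intro j
    by_cases h : j = l
    · subst h
      simp [mul_add]
    · simp [h]
  simp_rw [h1]
  rw [finsum_add_distrib (hx.subset fun j hj => ?_) ((Set.finite_singleton l).subset fun j hj => ?_)]
  · congr 1
    rw [finsum_eq_single _ l (fun j hj => by simp [hj])]
    simp
  · intro h
    simp [h] at hj
  · by_contra h
    simp_all

theorem sigmaP_eq (x : ℤ → ℤ) (k : ℤ) : sigmaP a1 a2 x k =
    x k + ∑ᶠ j : ℤ, (if k < j then pairJK a1 a2 j k else 0) * x j := by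
  simp [sigmaP, ite_mul]

theorem sigmaP_update (hx : x.support.Finite) (l v k : ℤ) :
    sigmaP a1 a2 (Function.update x l (x l + v)) k =
      sigmaP a1 a2 x k + if l = k then v else if k < l then pairJK a1 a2 l k * v else 0 := by
  rw [sigmaP_eq, sigmaP_eq, finsum_mul_update hx]
  by_cases h : l = k
  · subst h
    simp
    ring
  · rw [Function.update_of_ne (Ne.symm h), if_neg h]
    split_ifs <;> ring

theorem pairW_wtOf_update (hx : x.support.Finite) (l v k : ℤ) :
    pairW (wtOf a1 a2 (Function.update x l (x l + v))) (idx k) =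
      pairW (wtOf a1 a2 x) (idx k) - pairJK a1 a2 l k * v := by
  have h1 := finsum_mul_update hx (fun j => (alphaOf a1 a2 j).1) l v
  have h2 := finsum_mul_update hx (fun j => (alphaOf a1 a2 j).2) l v
  simp only [mul_comm (alphaOf a1 a2 _).1 _, mul_comm (alphaOf a1 a2 _).2 _] at h1 h2
  simp only [wtOf, h1, h2]
  unfold pairW idx pairJK alphaOf
  split_ifs <;> first | omega | (push_cast; ring)

theorem pairW_add (μ ν : ℤ × ℤ) (i : ℤ) : pairW (μ + ν) i = pairW μ i + pairW ν i := by
  unfold pairW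
  split_ifs <;> simp

theorem pairW_wtZ_update (hx : x.support.Finite) (μ : ℤ × ℤ) (l v k : ℤ) :
    pairW (wtZ a1 a2 μ (Function.update x l (x l + v))) (idx k) =
      pairW (wtZ a1 a2 μ x) (idx k) - pairJK a1 a2 l k * v := by
  rw [wtZ, wtZ, pairW_add, pairW_add, pairW_wtOf_update hx]
  ring

/-! ### The crystal structure on `ℤ^{+∞}` -/

theorem exists_eq_zero_of_lt (hx : x.support.Finite) : ∃ N : ℤ, ∀ k, N < k → x k = 0 := by
  obtain ⟨N, hN⟩ := hx.bddAbove
  refine ⟨N, fun k hk => ?_⟩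
  by_contra h
  exact absurd (hN h) (not_le.2 hk)

theorem exists_sigmaP_eq_zero (hx : x.support.Finite) :
    ∃ N : ℤ, ∀ k, N < k → sigmaP a1 a2 x k = 0 := by
  obtain ⟨N, hN⟩ := exists_eq_zero_of_lt hx
  refine ⟨N, fun k hk => ?_⟩
  rw [sigmaP, hN k hk, zero_add]
  refine finsum_eq_zero_of_forall_eq_zero fun j => ?_
  split_ifs with h
  · rw [hN j (hk.trans h), mul_zero]
  · rfl

theorem exists_idx_eq (N n : ℤ) : ∃ k, N < k ∧ 1 ≤ k ∧ idx k = idx n := by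
  refine ⟨n + 2 * (|N| + |n| + 1), ?_, ?_, ?_⟩
  · cases abs_cases N <;> cases abs_cases n <;> omega
  · cases abs_cases N <;> cases abs_cases n <;> omega
  · rw [idx_eq_iff]
    omega

theorem isGreatest_epsP (hx : x.support.Finite) (n : ℤ) :
    IsGreatest {s : ℤ | ∃ k : ℤ, 1 ≤ k ∧ idx k = idx n ∧ sigmaP a1 a2 x k = s}
      (epsP a1 a2 x (idx n)) := by
  obtain ⟨N, hN⟩ := exists_sigmaP_eq_zero (a1 := a1) (a2 := a2) hx
  obtain ⟨k, hk, hk1, hkn⟩ := exists_idx_eq N n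
  have hb : BddAbove {s : ℤ | ∃ k : ℤ, 1 ≤ k ∧ idx k = idx n ∧ sigmaP a1 a2 x k = s} := by
    refine (((Set.finite_Icc 1 N).image (sigmaP a1 a2 x)).insert 0).bddAbove.mono ?_
    rintro s ⟨l, hl, -, rfl⟩
    rcases lt_or_ge N l with h | h
    · exact Or.inl (hN l h)
    · exact Or.inr ⟨l, ⟨hl, h⟩, rfl⟩
  exact ⟨Int.csSup_mem ⟨_, k, hk1, hkn, rfl⟩ hb, fun s hs => le_csSup hb hs⟩

theorem sigmaP_le_epsP (hx : x.support.Finite) {n k : ℤ} (hk : 1 ≤ k) (h : idx k = idx n) :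
    sigmaP a1 a2 x k ≤ epsP a1 a2 x (idx n) :=
  (isGreatest_epsP hx n).2 ⟨k, hk, h, rfl⟩

theorem epsP_nonneg (hx : x.support.Finite) (n : ℤ) : 0 ≤ epsP a1 a2 x (idx n) := by
  obtain ⟨N, hN⟩ := exists_sigmaP_eq_zero (a1 := a1) (a2 := a2) hx
  obtain ⟨k, hk, hk1, hkn⟩ := exists_idx_eq N n
  rw [← hN k hk]
  exact sigmaP_le_epsP hx hk1 hkn

theorem isLeast_kminP (hx : x.support.Finite) (n : ℤ) :
    IsLeast {k : ℤ | 1 ≤ k ∧ idx k = idx n ∧ sigmaP a1 a2 x k = epsP a1 a2 x (idx n)}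
      (kminP a1 a2 x (idx n)) := by
  have hb : BddBelow {k : ℤ | 1 ≤ k ∧ idx k = idx n ∧ sigmaP a1 a2 x k = epsP a1 a2 x (idx n)} :=
    ⟨1, fun k hk => hk.1⟩
  exact ⟨Int.csInf_mem (isGreatest_epsP hx n).1 hb, fun s hs => csInf_le hb hs⟩

theorem sigmaP_lt_epsP (hx : x.support.Finite) {n k : ℤ} (hk : 1 ≤ k) (h : idx k = idx n)
    (hlt : k < kminP a1 a2 x (idx n)) : sigmaP a1 a2 x k < epsP a1 a2 x (idx n) :=
  lt_of_le_of_ne (sigmaP_le_epsP hx hk h)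
    fun he => absurd ((isLeast_kminP hx n).2 ⟨hk, h, he⟩) (not_le.2 hlt)

theorem finite_support_fP (hx : x.support.Finite) (i : ℤ) : (fP a1 a2 i x).support.Finite :=
  finite_support_update hx _ _

theorem finite_support_fPiter (hx : x.support.Finite) (i : ℤ) (n : ℕ) :
    (fPiter a1 a2 i n x).support.Finite := by
  induction n with
  | zero => exact hx
  | succ n ih =>
    rw [fPiter, Function.iterate_succ_apply']
    exact finite_support_fP ih i

theorem sigmaP_fP (hx : x.support.Finite) (n k : ℤ) :
    sigmaP a1 a2 (fP a1 a2 (idx n) x) k = sigmaP a1 a2 x k +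
      if kminP a1 a2 x (idx n) = k then 1
      else if k < kminP a1 a2 x (idx n) then pairJK a1 a2 n k else 0 := by
  rw [fP, sigmaP_update hx, mul_one, pairJK_congr (isLeast_kminP hx n).1.2.1]

theorem isGreatest_kmaxP_fP (hx : x.support.Finite) (n : ℤ) :
    epsP a1 a2 (fP a1 a2 (idx n) x) (idx n) = epsP a1 a2 x (idx n) + 1 ∧
    IsGreatest {k : ℤ | 1 ≤ k ∧ idx k = idx n ∧
      sigmaP a1 a2 (fP a1 a2 (idx n) x) k = epsP a1 a2 (fP a1 a2 (idx n) x) (idx n)}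
      (kminP a1 a2 x (idx n)) := by
  obtain ⟨⟨hk1, hkn, hke⟩, -⟩ := isLeast_kminP (a1 := a1) (a2 := a2) hx n
  have hs : sigmaP a1 a2 (fP a1 a2 (idx n) x) (kminP a1 a2 x (idx n)) =
      epsP a1 a2 x (idx n) + 1 := by
    rw [sigmaP_fP hx, if_pos rfl, hke]
  have he : epsP a1 a2 (fP a1 a2 (idx n) x) (idx n) = epsP a1 a2 x (idx n) + 1 := by
    refine (isGreatest_epsP (finite_support_fP hx _) n).unique ⟨⟨_, hk1, hkn, hs⟩, ?_⟩
    rintro s ⟨k, hk, hi, rfl⟩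
    rw [sigmaP_fP hx]
    split_ifs with h1 h2
    · have := sigmaP_le_epsP (a1 := a1) (a2 := a2) hx hk hi
      omega
    · have := sigmaP_lt_epsP hx hk hi h2
      rw [pairJK_of_idx_eq hi.symm]
      omega
    · have := sigmaP_le_epsP (a1 := a1) (a2 := a2) hx hk hi
      omega
  refine ⟨he, ⟨hk1, hkn, hs.trans he.symm⟩, ?_⟩
  rintro k ⟨hk, hi, hke'⟩
  by_contra! hlt
  rw [sigmaP_fP hx, if_neg hlt.ne, if_neg hlt.not_gt, he] at hke'
  have := sigmaP_le_epsP (a1 := a1) (a2 := a2) hx hk hi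
  omega

theorem epsP_fP (hx : x.support.Finite) (n : ℤ) :
    epsP a1 a2 (fP a1 a2 (idx n) x) (idx n) = epsP a1 a2 x (idx n) + 1 :=
  (isGreatest_kmaxP_fP hx n).1

theorem epsP_fPiter (hx : x.support.Finite) (n : ℤ) (m : ℕ) :
    epsP a1 a2 (fPiter a1 a2 (idx n) m x) (idx n) = epsP a1 a2 x (idx n) + m := by
  induction m with
  | zero => simp [fPiter]
  | succ m ih =>
    rw [fPiter, Function.iterate_succ_apply', ← fPiter, epsP_fP (finite_support_fPiter hx _ _), ih]
    push_cast
    ring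

theorem update_fP_sub_one (i : ℤ) :
    Function.update (fP a1 a2 i x) (kminP a1 a2 x i) (fP a1 a2 i x (kminP a1 a2 x i) - 1) = x := by
  simp [fP]

theorem eP_fP (hx : x.support.Finite) (n : ℤ) :
    eP a1 a2 (idx n) (fP a1 a2 (idx n) x) = some x := by
  obtain ⟨he, hg⟩ := isGreatest_kmaxP_fP (a1 := a1) (a2 := a2) hx n
  have h0 := epsP_nonneg (a1 := a1) (a2 := a2) hx n
  have hk : kmaxP a1 a2 (fP a1 a2 (idx n) x) (idx n) = kminP a1 a2 x (idx n) := hg.csSup_eq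
  rw [eP, if_pos (by omega), hk, update_fP_sub_one]

theorem ePiterO_fPiter (hx : x.support.Finite) (n : ℤ) (m : ℕ) :
    ePiterO a1 a2 (idx n) m (some (fPiter a1 a2 (idx n) m x)) = some x := by
  induction m with
  | zero => rfl
  | succ m ih =>
    rw [ePiterO, Function.iterate_succ_apply, fPiter, Function.iterate_succ_apply', Option.bind_some,
      ← fPiter, eP_fP (finite_support_fPiter hx _ _)]
    exact ih

theorem fP_apply_of_nonpos (hx : x.support.Finite) (n : ℤ) {k : ℤ} (hk : k ≤ 0) :
    fP a1 a2 (idx n) x k = x k := by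
  have := (isLeast_kminP (a1 := a1) (a2 := a2) hx n).1.1
  rw [fP, Function.update_of_ne (by omega)]

theorem fPiter_apply_of_nonpos (hx : x.support.Finite) (n : ℤ) (m : ℕ) {k : ℤ} (hk : k ≤ 0) :
    fPiter a1 a2 (idx n) m x k = x k := by
  induction m with
  | zero => rfl
  | succ m ih =>
    rw [fPiter, Function.iterate_succ_apply', ← fPiter,
      fP_apply_of_nonpos (finite_support_fPiter hx _ _) _ hk, ih]

/-! ### Iterating `f̃_i` on an element with `ε_i = 0` -/

theorem antitone_of_eq_min {A s : ℤ → ℤ} {n m : ℤ} (hA0 : ∀ k ≤ 2, idx k = idx n → A k = m)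
    (hA : ∀ k, 1 ≤ k → idx k = idx n → A (k + 2) = min (A k) (s k)) :
    ∀ k l, idx k = idx n → idx l = idx n → k ≤ l → A l ≤ A k := by
  have hle : ∀ k, idx k = idx n → ∀ j : ℕ, A (k + 2 * j) ≤ A k := by
    intro k hi j
    induction j with
    | zero => simp
    | succ j ihj =>
      have hij : idx (k + 2 * (j : ℤ)) = idx n := by rw [← hi, idx_eq_iff]; omega
      have hij' : idx (k + 2 * ((j + 1 : ℕ) : ℤ)) = idx n := by rw [← hi, idx_eq_iff]; omega
      rcases lt_or_ge (k + 2 * (j : ℤ)) 1 with h | h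
      · have e1 := hA0 _ (by omega) hij
        have e2 := hA0 _ (by push_cast; omega) hij'
        omega
      · have := hA _ h hij
        have e : k + 2 * ((j + 1 : ℕ) : ℤ) = k + 2 * (j : ℤ) + 2 := by push_cast; ring
        rw [e]
        omega
  intro k l hk hl hkl
  have hp := idx_eq_iff.1 (hk.trans hl.symm)
  have := hle k hk ((l - k) / 2).toNat
  rwa [show k + 2 * (((l - k) / 2).toNat : ℤ) = l by omega] at this

/-- `A k` is the total amount that `f̃_i^m` adds to the coordinates of `x` in positions `≥ k`. -/
theorem exists_fPiter_increments (hx : x.support.Finite) (n : ℤ)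
    (h0 : ∀ k, 1 ≤ k → idx k = idx n → sigmaP a1 a2 x k ≤ 0) (m : ℕ) :
    ∃ A : ℤ → ℤ, (∀ k ≤ 2, idx k = idx n → A k = m) ∧
      (∀ k, 1 ≤ k → idx k = idx n → A (k + 2) = min (A k) (-sigmaP a1 a2 x k)) ∧
      (∀ k, 1 ≤ k → idx k = idx n →
        sigmaP a1 a2 (fPiter a1 a2 (idx n) m x) k = sigmaP a1 a2 x k + A k + A (k + 2)) ∧
      (∀ k, 1 ≤ k → idx k ≠ idx n →
        sigmaP a1 a2 (fPiter a1 a2 (idx n) m x) k =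
          sigmaP a1 a2 x k - aIdx a1 a2 k * A (k + 1)) := by
  have hε : epsP a1 a2 x (idx n) = 0 := by
    refine le_antisymm ?_ (epsP_nonneg hx n)
    obtain ⟨k, hk, hi, hs⟩ := (isGreatest_epsP (a1 := a1) (a2 := a2) hx n).1
    exact hs ▸ h0 k hk hi
  induction m with
  | zero =>
    refine ⟨fun _ => 0, by simp, fun k hk hi => ?_, by simp [fPiter], by simp [fPiter]⟩
    have := h0 k hk hi
    beta_reduce
    omega
  | succ m ih =>
    obtain ⟨A, hA0, hA, hs, ht⟩ := ih
    set z := fPiter a1 a2 (idx n) m x with hz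
    have hzf : z.support.Finite := finite_support_fPiter hx _ _
    have hzε : epsP a1 a2 z (idx n) = m := by rw [hz, epsP_fPiter hx, hε, zero_add]
    have hsucc : fPiter a1 a2 (idx n) (m + 1) x = fP a1 a2 (idx n) z := by
      rw [fPiter, Function.iterate_succ_apply', ← fPiter]
    have hanti := antitone_of_eq_min hA0 hA
    have hAm : ∀ k, idx k = idx n → A k ≤ m := by
      intro k hk
      rcases le_or_gt k 2 with h | h
      · exact (hA0 k h hk).le
      · have e : idx (k - 2 * (k / 2)) = idx n := by rw [← hk, idx_eq_iff]; omega
        rw [← hA0 (k - 2 * (k / 2)) (by omega) e]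
        exact hanti _ _ e hk (by omega)
    obtain ⟨⟨hk1, hkn, hke⟩, -⟩ := isLeast_kminP (a1 := a1) (a2 := a2) hzf n
    set k0 := kminP a1 a2 z (idx n) with hk0
    have hsk0 := hs k0 hk1 hkn
    have hAk0 := hA k0 hk1 hkn
    have hmk0 := hAm k0 hkn
    rw [hke, hzε] at hsk0
    have hbelow : ∀ k, 1 ≤ k → idx k = idx n → k < k0 →
        A k = m ∧ A (k + 2) = m ∧ (m : ℤ) < -sigmaP a1 a2 x k := by
      intro k hk hi hlt
      have hp := idx_eq_iff.1 (hi.trans hkn.symm)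
      have hi2 : idx (k + 2) = idx n := by rw [← hi, idx_eq_iff]; omega
      have h1 := hanti k k0 hi hkn hlt.le
      have h2 := hanti (k + 2) k0 hi2 hkn (by omega)
      have h3 := sigmaP_lt_epsP hzf hk hi hlt
      rw [hzε, hs k hk hi] at h3
      have h4 := hAm k hi
      have h5 := hAm (k + 2) hi2
      omega
    refine ⟨fun k => A k + if k ≤ k0 then 1 else 0, ?_, ?_, ?_, ?_⟩
    · intro k hk hi
      have hp := idx_eq_iff.1 (hi.trans hkn.symm)
      have := hA0 k hk hi
      beta_reduce
      push_cast
      split_ifs <;> omega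
    · intro k hk hi
      have hp := idx_eq_iff.1 (hi.trans hkn.symm)
      have hAk := hA k hk hi
      beta_reduce
      rcases lt_trichotomy k k0 with h | rfl | h
      · have := hbelow k hk hi h
        split_ifs <;> omega
      · split_ifs <;> omega
      · split_ifs <;> omega
    · intro k hk hi
      have hp := idx_eq_iff.1 (hi.trans hkn.symm)
      rw [hsucc, sigmaP_fP hzf, hs k hk hi, pairJK_of_idx_eq hi.symm, ← hk0]
      beta_reduce
      split_ifs <;> omega
    · intro k hk hi
      have hne : k ≠ k0 := fun h => hi (h ▸ hkn)
      rw [hsucc, sigmaP_fP hzf, ht k hk hi, pairJK_of_idx_ne hi.symm, ← hk0, if_neg hne.symm]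
      beta_reduce
      rcases lt_or_gt_of_ne hne with h | h
      · rw [if_pos h, if_pos (show k + 1 ≤ k0 by omega)]
        ring
      · rw [if_neg h.not_gt, if_neg (show ¬k + 1 ≤ k0 by omega)]
        ring

/-! ### The cone condition with the limit slopes `γ_k` -/

theorem gammaR_congr {k l : ℤ} (h : idx k = idx l) : gammaR a1 a2 k = gammaR a1 a2 l := by
  rw [idx_eq_iff] at h
  simp [gammaR, h]

theorem alphaR_pos (h1 : 1 ≤ a1) (h2 : 1 ≤ a2) : 0 < alphaR a1 a2 := by
  have h1' : (1 : ℝ) ≤ a1 := by exact_mod_cast h1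
  have h2' : (1 : ℝ) ≤ a2 := by exact_mod_cast h2
  have := Real.sqrt_nonneg ((a1 : ℝ) ^ 2 * (a2 : ℝ) ^ 2 - 4 * a1 * a2)
  unfold alphaR
  positivity

theorem betaR_eq_alphaR_swap : betaR a1 a2 = alphaR a2 a1 := by
  unfold alphaR betaR
  ring_nf

theorem betaR_mul (h1 : 1 ≤ a1) (h2 : 1 ≤ a2) (h : 4 < a1 * a2) :
    betaR a1 a2 * (a1 - alphaR a1 a2) = 1 := by
  have h1' : (1 : ℝ) ≤ a1 := by exact_mod_cast h1
  have h2' : (1 : ℝ) ≤ a2 := by exact_mod_cast h2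
  have h' : (4 : ℝ) < a1 * a2 := by exact_mod_cast h
  have hs : Real.sqrt ((a1 : ℝ) ^ 2 * (a2 : ℝ) ^ 2 - 4 * a1 * a2) ^ 2 =
      (a1 : ℝ) ^ 2 * (a2 : ℝ) ^ 2 - 4 * a1 * a2 := Real.sq_sqrt (by nlinarith)
  unfold alphaR betaR
  generalize Real.sqrt _ = s at hs ⊢
  field_simp
  linear_combination -hs

theorem gammaR_pos (h1 : 1 ≤ a1) (h2 : 1 ≤ a2) (k : ℤ) : 0 < gammaR a1 a2 k := by
  unfold gammaR
  split_ifs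
  · exact alphaR_pos h1 h2
  · rw [betaR_eq_alphaR_swap]
    exact alphaR_pos h2 h1

theorem gammaR_mul (h1 : 1 ≤ a1) (h2 : 1 ≤ a2) (h : 4 < a1 * a2) (k : ℤ) :
    gammaR a1 a2 k * (aIdx a1 a2 k - gammaR a1 a2 (k + 1)) = 1 := by
  unfold gammaR aIdx
  rcases Int.emod_two_eq_zero_or_one k with hk | hk
  · rw [if_pos hk, if_neg (show ¬(k + 1) % 2 = 0 by omega), if_neg (by omega),
      betaR_eq_alphaR_swap, ← betaR_eq_alphaR_swap (a1 := a2)]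
    exact betaR_mul h2 h1 (by rwa [mul_comm])
  · rw [if_neg (by omega), if_pos (show (k + 1) % 2 = 0 by omega), if_pos hk]
    exact betaR_mul h1 h2 h

theorem gammaR_swap (k : ℤ) : gammaR a2 a1 (1 - k) = gammaR a1 a2 k := by
  unfold gammaR
  split_ifs
  · omega
  · rw [betaR_eq_alphaR_swap]
  · rw [betaR_eq_alphaR_swap]
  · omega

/-- The invariant of `f̃_{i_n}^m ⋯` along a string in the cone: `A k` is the amount which the last
step `f̃_{i_n}^m` has added in positions `≥ k`. -/
def ConeBound (a1 a2 n m : ℤ) (y : ℤ → ℤ) : Prop :=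
  ∃ A : ℤ → ℤ, (∀ k ≤ 2, idx k = idx n → A k = m) ∧
    (∀ k l, idx k = idx n → idx l = idx n → k ≤ l → A l ≤ A k) ∧
    (∀ k, idx k = idx n → 0 ≤ A k) ∧
    (∀ k, 1 ≤ k → idx k = idx n → sigmaP a1 a2 y k ≤ A k) ∧
    (∀ k, 1 ≤ k → idx k ≠ idx n →
      gammaR a1 a2 k * (sigmaP a1 a2 y k : ℝ) ≤ -(A (k + 1) : ℝ))

theorem sigmaP_zero (k : ℤ) : sigmaP a1 a2 (fun _ => 0) k = 0 := by simp [sigmaP]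

theorem coneBound_zero (n : ℤ) : ConeBound a1 a2 n 0 (fun _ => 0) :=
  ⟨fun _ => 0, by simp, by simp, by simp, by simp [sigmaP_zero], by simp [sigmaP_zero]⟩

theorem ConeBound.sigmaP_nonpos (h1 : 1 ≤ a1) (h2 : 1 ≤ a2) {n n' m : ℤ}
    (h : ConeBound a1 a2 n m y) (hn : idx n' ≠ idx n) {k : ℤ} (hk : 1 ≤ k) (hi : idx k = idx n') :
    sigmaP a1 a2 y k ≤ 0 := by
  obtain ⟨A, -, -, hpos, -, hs⟩ := h
  have hi' : idx k ≠ idx n := hi ▸ hn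
  have h3 := hs k hk hi'
  have h4 : (0 : ℝ) ≤ A (k + 1) := by
    exact_mod_cast hpos (k + 1) (by rw [idx_ne_iff] at hi'; rw [idx_eq_iff]; omega)
  have h5 := gammaR_pos h1 h2 k
  by_contra! h6
  have h7 : (0 : ℝ) < sigmaP a1 a2 y k := by exact_mod_cast h6
  nlinarith [mul_pos h5 h7]

theorem ConeBound.epsP_eq_zero (h1 : 1 ≤ a1) (h2 : 1 ≤ a2) (hy : y.support.Finite) {n n' m : ℤ}
    (h : ConeBound a1 a2 n m y) (hn : idx n' ≠ idx n) : epsP a1 a2 y (idx n') = 0 := by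
  refine le_antisymm ?_ (epsP_nonneg hy n')
  obtain ⟨k, hk, hi, hs⟩ := (isGreatest_epsP (a1 := a1) (a2 := a2) hy n').1
  exact hs ▸ h.sigmaP_nonpos h1 h2 hn hk hi

theorem ConeBound.fPiter (h1 : 1 ≤ a1) (h2 : 1 ≤ a2) (ha : 4 < a1 * a2) (hy : y.support.Finite)
    {n n' m : ℤ} {m' : ℕ} (h : ConeBound a1 a2 n m y) (hn : idx n' ≠ idx n)
    (hm : (m : ℝ) ≤ gammaR a1 a2 n' * m') :
    ConeBound a1 a2 n' m' (fPiter a1 a2 (idx n') m' y) := by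
  obtain ⟨A', hA0', hA', hs', ht'⟩ := exists_fPiter_increments (a1 := a1) (a2 := a2) hy n'
    (fun k hk hi => h.sigmaP_nonpos h1 h2 hn hk hi) m'
  have hanti' := antitone_of_eq_min hA0' hA'
  have hsig : ∀ k, 1 ≤ k → idx k = idx n' → sigmaP a1 a2 y k ≤ 0 :=
    fun k hk hi => h.sigmaP_nonpos h1 h2 hn hk hi
  obtain ⟨A, hA0, hanti, hpos, hs, ht⟩ := h
  have hp := idx_ne_iff.1 hn
  have hcmp : ∀ j : ℕ, (A (n % 2 + 2 * j) : ℝ) ≤ gammaR a1 a2 n' * A' (n % 2 + 2 * j + 1) := by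
    intro j
    induction j with
    | zero =>
      rw [hA0 _ (by push_cast; omega) (by rw [idx_eq_iff]; push_cast; omega),
        hA0' _ (by push_cast; omega) (by rw [idx_eq_iff]; push_cast; omega)]
      exact_mod_cast hm
    | succ j ih =>
      set k : ℤ := n % 2 + 2 * j with hk
      have e : n % 2 + 2 * ((j + 1 : ℕ) : ℤ) = k + 2 := by push_cast; omega
      have i1 : idx (k + 1) = idx n' := by rw [idx_eq_iff]; omega
      have i2 : idx k = idx n := by rw [idx_eq_iff]; omega
      have i3 : idx (k + 2) = idx n := by rw [idx_eq_iff]; omega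
      have e1 : (A (k + 2) : ℝ) ≤ A k := by exact_mod_cast hanti k (k + 2) i2 i3 (by omega)
      have e2 := ht (k + 1) (by omega) (i1 ▸ hn)
      have e3 := hA' (k + 1) (by omega) i1
      rw [gammaR_congr i1, show k + 1 + 1 = k + 2 by ring] at e2
      rw [e, show k + 2 + 1 = k + 1 + 2 by ring, e3]
      rcases min_cases (A' (k + 1)) (-sigmaP a1 a2 y (k + 1)) with ⟨h3, -⟩ | ⟨h3, -⟩
      · rw [h3]
        linarith
      · rw [h3]
        push_cast
        linarith
  refine ⟨A', hA0', hanti', ?_, ?_, ?_⟩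
  · have hstep : ∀ j : ℕ, 0 ≤ A' (n' % 2 + 2 * j) := by
      intro j
      induction j with
      | zero =>
        rw [hA0' _ (by push_cast; omega) (by rw [idx_eq_iff]; push_cast; omega)]
        positivity
      | succ j ih =>
        rcases lt_or_ge (n' % 2 + 2 * (j : ℤ)) 1 with h | h
        · rw [hA0' _ (by push_cast; omega) (by rw [idx_eq_iff]; push_cast; omega)]
          positivity
        · have i1 : idx (n' % 2 + 2 * (j : ℤ)) = idx n' := by rw [idx_eq_iff]; omega
          have e3 := hA' _ h i1
          have e4 := hsig _ h i1
          rw [show n' % 2 + 2 * ((j + 1 : ℕ) : ℤ) = n' % 2 + 2 * (j : ℤ) + 2 by push_cast; ring]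
          omega
    intro k hk
    have hk' := idx_eq_iff.1 hk
    rcases le_or_gt k 2 with h | h
    · rw [hA0' k h hk]
      positivity
    · have := hstep ((k - n' % 2) / 2).toNat
      rwa [show n' % 2 + 2 * (((k - n' % 2) / 2).toNat : ℤ) = k by omega] at this
  · intro k hk hi
    have e1 := hA' k hk hi
    rw [hs' k hk hi]
    omega
  · intro k hk hi
    have hi' := idx_ne_iff.1 hi
    have i1 : idx k = idx n := by rw [idx_eq_iff]; omega
    have i2 : idx (k + 1) = idx n' := by rw [idx_eq_iff]; omega
    have e1 := hcmp ((k - n % 2) / 2).toNat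
    rw [show n % 2 + 2 * (((k - n % 2) / 2).toNat : ℤ) = k by omega, ← gammaR_congr i2] at e1
    have e2 : (sigmaP a1 a2 y k : ℝ) ≤ A k := by exact_mod_cast hs k hk i1
    have e3 := gammaR_mul h1 h2 ha k
    have e4 := gammaR_pos h1 h2 k
    rw [ht' k hk hi]
    push_cast
    have e5 := mul_le_mul_of_nonneg_left (e2.trans e1) e4.le
    linear_combination e5 - (A' (k + 1) : ℝ) * e3

/-! ### The reflection exchanging `ℤ^{+∞}` and `ℤ^{−∞}` -/

/-- The reflection `k ↦ 1 - k` of coordinates together with a sign. -/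
def mirror (x : ℤ → ℤ) : ℤ → ℤ := fun k => -x (1 - k)

theorem finite_support_mirror (hx : x.support.Finite) : (mirror x).support.Finite := by
  refine (hx.image (fun k => 1 - k)).subset fun k hk => ⟨1 - k, ?_, by ring⟩
  simpa [mirror] using hk

theorem pairJK_swap (j k : ℤ) : pairJK a2 a1 (1 - j) (1 - k) = pairJK a1 a2 j k := by
  unfold pairJK
  split_ifs <;> first | rfl | omega

theorem sigmaM_eq (x : ℤ → ℤ) (k : ℤ) :
    sigmaM a1 a2 x k = sigmaP a2 a1 (mirror x) (1 - k) := by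
  rw [sigmaM, sigmaP, ← finsum_comp_equiv (Equiv.subLeft (1 : ℤ)), sub_eq_add_neg,
    ← finsum_neg_distrib]
  congr 1
  · simp [mirror]
  · refine finsum_congr fun j => ?_
    have h := pairJK_swap (a1 := a1) (a2 := a2) (1 - j) k
    rw [sub_sub_cancel] at h
    simp only [Equiv.subLeft_apply, mirror, h]
    split_ifs <;> first | omega | ring

theorem phiMf_eq (x : ℤ → ℤ) (n : ℤ) :
    phiMf a1 a2 x (idx n) = epsP a2 a1 (mirror x) (idx (1 - n)) := by
  unfold phiMf epsP
  congr 1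
  ext s
  constructor
  · rintro ⟨k, hk, hi, rfl⟩
    rw [idx_eq_iff] at hi
    exact ⟨1 - k, by omega, by rw [idx_eq_iff]; omega, (sigmaM_eq x k).symm⟩
  · rintro ⟨k, hk, hi, rfl⟩
    rw [idx_eq_iff] at hi
    exact ⟨1 - k, by omega, by rw [idx_eq_iff]; omega, by rw [sigmaM_eq, sub_sub_cancel]⟩

theorem isGreatest_one_sub_kminP (hx : x.support.Finite) (n : ℤ) :
    IsGreatest {k : ℤ | k ≤ 0 ∧ idx k = idx n ∧ sigmaM a1 a2 x k = phiMf a1 a2 x (idx n)}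
      (1 - kminP a2 a1 (mirror x) (idx (1 - n))) := by
  obtain ⟨⟨hk1, hkn, hke⟩, hl⟩ :=
    isLeast_kminP (a1 := a2) (a2 := a1) (finite_support_mirror hx) (1 - n)
  constructor
  · refine ⟨by omega, ?_, ?_⟩
    · rw [idx_eq_iff] at hkn ⊢
      omega
    · rw [sigmaM_eq, sub_sub_cancel, hke, phiMf_eq]
  · rintro k ⟨hk, hi, hs⟩
    rw [sigmaM_eq, phiMf_eq] at hs
    rw [idx_eq_iff] at hi
    have := hl ⟨by omega, by rw [idx_eq_iff]; omega, hs⟩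
    omega

theorem kmaxM_eq (hx : x.support.Finite) (n : ℤ) :
    kmaxM a1 a2 x (idx n) = 1 - kminP a2 a1 (mirror x) (idx (1 - n)) :=
  (isGreatest_one_sub_kminP hx n).csSup_eq

theorem isGreatest_kmaxM (hx : x.support.Finite) (n : ℤ) :
    IsGreatest {k : ℤ | k ≤ 0 ∧ idx k = idx n ∧ sigmaM a1 a2 x k = phiMf a1 a2 x (idx n)}
      (kmaxM a1 a2 x (idx n)) := by
  rw [kmaxM_eq hx]
  exact isGreatest_one_sub_kminP hx n

theorem sigmaM_le_phiMf (hx : x.support.Finite) {n k : ℤ} (hk : k ≤ 0) (h : idx k = idx n) :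
    sigmaM a1 a2 x k ≤ phiMf a1 a2 x (idx n) := by
  rw [sigmaM_eq, phiMf_eq]
  refine sigmaP_le_epsP (finite_support_mirror hx) (by omega) ?_
  rw [idx_eq_iff] at h ⊢
  omega

theorem mirror_eM (hx : x.support.Finite) (n : ℤ) :
    mirror (eM a1 a2 (idx n) x) = fP a2 a1 (idx (1 - n)) (mirror x) := by
  ext k
  rw [mirror, eM, fP, kmaxM_eq hx]
  by_cases h : k = kminP a2 a1 (mirror x) (idx (1 - n))
  · subst h
    simp [mirror]
    ring
  · rw [Function.update_of_ne (by omega), Function.update_of_ne h, mirror]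

theorem finite_support_eMiter (hx : x.support.Finite) (i : ℤ) (m : ℕ) :
    (eMiter a1 a2 i m x).support.Finite := by
  induction m with
  | zero => exact hx
  | succ m ih =>
    rw [eMiter, Function.iterate_succ_apply']
    exact finite_support_update ih _ _

theorem mirror_eMiter (hx : x.support.Finite) (n : ℤ) (m : ℕ) :
    mirror (eMiter a1 a2 (idx n) m x) = fPiter a2 a1 (idx (1 - n)) m (mirror x) := by
  induction m with
  | zero => rfl
  | succ m ih =>
    rw [eMiter, Function.iterate_succ_apply', ← eMiter, mirror_eM (finite_support_eMiter hx _ _),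
      ih, fPiter, fPiter, Function.iterate_succ_apply']

theorem phiMf_eMiter (hx : x.support.Finite) (n : ℤ) (m : ℕ) :
    phiMf a1 a2 (eMiter a1 a2 (idx n) m x) (idx n) = phiMf a1 a2 x (idx n) + m := by
  rw [phiMf_eq, phiMf_eq, mirror_eMiter hx, epsP_fPiter (finite_support_mirror hx)]

theorem phiMf_nonneg (hx : x.support.Finite) (n : ℤ) : 0 ≤ phiMf a1 a2 x (idx n) := by
  rw [phiMf_eq]
  exact epsP_nonneg (finite_support_mirror hx) _

/-! ### The crystal structure on `Z_ι(μ)` -/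

theorem finite_support_combine (hy : y.support.Finite) (hw : w.support.Finite) :
    (combine y w).support.Finite := by
  refine (hy.union hw).subset fun k hk => ?_
  simp only [combine, Function.mem_support] at hk
  split_ifs at hk
  · exact Or.inl hk
  · exact Or.inr hk

theorem combine_update_left {k : ℤ} (hk : 1 ≤ k) (v : ℤ) :
    combine (Function.update y k v) w = Function.update (combine y w) k v := by
  ext j
  by_cases h : j = k
  · subst h
    simp [combine, hk]
  · simp [combine, h]

theorem combine_update_right {k : ℤ} (hk : k ≤ 0) (v : ℤ) :
    combine y (Function.update w k v) = Function.update (combine y w) k v := by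
  ext j
  by_cases h : j = k
  · subst h
    simp [combine, show ¬1 ≤ j by omega]
  · simp [combine, h]

theorem sigmaZ_combine_of_pos (μ : ℤ × ℤ) {k : ℤ} (hk : 1 ≤ k) :
    sigmaZ a1 a2 μ (combine y w) k = sigmaP a1 a2 y k := by
  rw [sigmaZ, if_pos hk, sigmaP, sigmaP, combine, if_pos hk]
  congr 1
  refine finsum_congr fun j => ?_
  split_ifs with h
  · rw [combine, if_pos (by omega)]
  · rfl

theorem sigmaZ_combine_of_nonpos (μ : ℤ × ℤ) {k : ℤ} (hk : k ≤ 0) :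
    sigmaZ a1 a2 μ (combine y w) k =
      sigmaM a1 a2 w k - pairW (wtZ a1 a2 μ (combine y w)) (idx k) := by
  rw [sigmaZ, if_neg (by omega), sigmaM, sigmaM]
  congr 2
  · rw [combine, if_neg (by omega)]
  · refine finsum_congr fun j => ?_
    split_ifs with h
    · rw [combine, if_neg (by omega)]
    · rfl

theorem epsZ_combine (hy : y.support.Finite) (hw : w.support.Finite) (μ : ℤ × ℤ) (n : ℤ) :
    epsZ a1 a2 μ (combine y w) (idx n) =
      max (epsP a1 a2 y (idx n))
        (phiMf a1 a2 w (idx n) - pairW (wtZ a1 a2 μ (combine y w)) (idx n)) := by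
  refine IsGreatest.csSup_eq ⟨?_, ?_⟩
  · rcases max_cases (epsP a1 a2 y (idx n))
        (phiMf a1 a2 w (idx n) - pairW (wtZ a1 a2 μ (combine y w)) (idx n)) with ⟨h, -⟩ | ⟨h, -⟩
    · rw [h]
      obtain ⟨k, hk, hi, hs⟩ := (isGreatest_epsP (a1 := a1) (a2 := a2) hy n).1
      exact ⟨k, hi, by rw [sigmaZ_combine_of_pos μ hk, hs]⟩
    · rw [h]
      obtain ⟨hk, hi, hs⟩ := (isGreatest_kmaxM (a1 := a1) (a2 := a2) hw n).1
      exact ⟨_, hi, by rw [sigmaZ_combine_of_nonpos μ hk, hs, hi]⟩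
  · rintro s ⟨k, hi, rfl⟩
    rcases lt_or_ge k 1 with hk | hk
    · have hk : k ≤ 0 := by omega
      rw [sigmaZ_combine_of_nonpos μ hk, hi]
      exact le_max_of_le_right (sub_le_sub_right (sigmaM_le_phiMf hw hk hi) _)
    · rw [sigmaZ_combine_of_pos μ hk]
      exact le_max_of_le_left (sigmaP_le_epsP hy hk hi)

theorem eZ_combine_right (hy : y.support.Finite) (hw : w.support.Finite) (μ : ℤ × ℤ) (n : ℤ)
    (h : epsP a1 a2 y (idx n) <
      phiMf a1 a2 w (idx n) - pairW (wtZ a1 a2 μ (combine y w)) (idx n)) :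
    eZ a1 a2 μ (idx n) (combine y w) = some (combine y (eM a1 a2 (idx n) w)) := by
  have hε := epsZ_combine (a1 := a1) (a2 := a2) hy hw μ n
  rw [max_eq_right h.le] at hε
  obtain ⟨⟨hk, hi, hs⟩, hg⟩ := isGreatest_kmaxM (a1 := a1) (a2 := a2) hw n
  have hkm : kmaxZ a1 a2 μ (combine y w) (idx n) = kmaxM a1 a2 w (idx n) := by
    refine IsGreatest.csSup_eq ⟨⟨hi, by rw [sigmaZ_combine_of_nonpos μ hk, hs, hi, hε]⟩, ?_⟩
    rintro k ⟨hik, hsk⟩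
    rcases lt_or_ge k 1 with hk' | hk'
    · have hk' : k ≤ 0 := by omega
      rw [sigmaZ_combine_of_nonpos μ hk', hik, hε] at hsk
      exact hg ⟨hk', hik, by omega⟩
    · rw [sigmaZ_combine_of_pos μ hk', hε] at hsk
      have := sigmaP_le_epsP (a1 := a1) (a2 := a2) hy hk' hik
      omega
  have h0 := epsP_nonneg (a1 := a1) (a2 := a2) hy n
  rw [eZ, if_pos (by omega), hkm, eM, combine_update_right hk, combine, if_neg (by omega)]

theorem eZ_combine_fP (hy : y.support.Finite) (hw : w.support.Finite) (μ : ℤ × ℤ) (n : ℤ)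
    (h : phiMf a1 a2 w (idx n) -
      pairW (wtZ a1 a2 μ (combine (fP a1 a2 (idx n) y) w)) (idx n) ≤ epsP a1 a2 y (idx n) + 1) :
    eZ a1 a2 μ (idx n) (combine (fP a1 a2 (idx n) y) w) = some (combine y w) := by
  obtain ⟨he, ⟨hk, hi, hs⟩, hg⟩ := isGreatest_kmaxP_fP (a1 := a1) (a2 := a2) hy n
  have hε := epsZ_combine (a1 := a1) (a2 := a2) (finite_support_fP (a1 := a1) (a2 := a2) hy (idx n)) hw μ n
  rw [max_eq_left (he ▸ h)] at hε
  have hkm : kmaxZ a1 a2 μ (combine (fP a1 a2 (idx n) y) w) (idx n) = kminP a1 a2 y (idx n) := by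
    refine IsGreatest.csSup_eq ⟨⟨hi, by rw [sigmaZ_combine_of_pos μ hk, hs, hε]⟩, ?_⟩
    rintro k ⟨hik, hsk⟩
    rcases lt_or_ge k 1 with hk' | hk'
    · omega
    · rw [sigmaZ_combine_of_pos μ hk', hε] at hsk
      exact hg ⟨hk', hik, hsk⟩
  have h0 := epsP_nonneg (a1 := a1) (a2 := a2) hy n
  have hc : combine (fP a1 a2 (idx n) y) w (kminP a1 a2 y (idx n)) =
      fP a1 a2 (idx n) y (kminP a1 a2 y (idx n)) := by rw [combine, if_pos hk]
  rw [eZ, if_pos (by omega), hkm, hc, ← combine_update_left hk, update_fP_sub_one]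

theorem fZ_combine_left (hy : y.support.Finite) (hw : w.support.Finite) (μ : ℤ × ℤ) (n : ℤ)
    (h : phiMf a1 a2 w (idx n) - pairW (wtZ a1 a2 μ (combine y w)) (idx n) <
      epsP a1 a2 y (idx n)) :
    fZ a1 a2 μ (idx n) (combine y w) = some (combine (fP a1 a2 (idx n) y) w) := by
  have hε := epsZ_combine (a1 := a1) (a2 := a2) hy hw μ n
  rw [max_eq_left h.le] at hε
  obtain ⟨⟨hk, hi, hs⟩, hl⟩ := isLeast_kminP (a1 := a1) (a2 := a2) hy n
  have hkm : kminZ a1 a2 μ (combine y w) (idx n) = kminP a1 a2 y (idx n) := by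
    refine IsLeast.csInf_eq ⟨⟨hi, by rw [sigmaZ_combine_of_pos μ hk, hs, hε]⟩, ?_⟩
    rintro k ⟨hik, hsk⟩
    rcases lt_or_ge k 1 with hk' | hk'
    · have hk' : k ≤ 0 := by omega
      rw [sigmaZ_combine_of_nonpos μ hk', hik, hε] at hsk
      have := sigmaM_le_phiMf (a1 := a1) (a2 := a2) hw hk' hik
      omega
    · rw [sigmaZ_combine_of_pos μ hk', hε] at hsk
      exact hl ⟨hk', hik, hsk⟩
  have h0 := phiMf_nonneg (a1 := a1) (a2 := a2) hw n
  rw [fZ, phiZ, if_pos (by omega), hkm, fP, combine_update_left hk, combine, if_pos hk]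

theorem pairW_combine_fPiter (hy : y.support.Finite) (hw : w.support.Finite) (μ : ℤ × ℤ)
    (n k : ℤ) (m : ℕ) :
    pairW (wtZ a1 a2 μ (combine (fPiter a1 a2 (idx n) m y) w)) (idx k) =
      pairW (wtZ a1 a2 μ (combine y w)) (idx k) - m * pairJK a1 a2 n k := by
  induction m with
  | zero => simp [fPiter]
  | succ m ih =>
    have hz := finite_support_fPiter (a1 := a1) (a2 := a2) hy (idx n) m
    obtain ⟨⟨hk, hi, -⟩, -⟩ := isLeast_kminP (a1 := a1) (a2 := a2) hz n
    rw [fPiter, Function.iterate_succ_apply', ← fPiter, fP, combine_update_left hk]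
    have := pairW_wtZ_update (a1 := a1) (a2 := a2) (finite_support_combine hz hw) μ
      (kminP a1 a2 (fPiter a1 a2 (idx n) m y) (idx n)) 1 k
    rw [combine, if_pos hk] at this
    rw [this, ih, pairJK_congr hi]
    push_cast
    ring

theorem pairW_combine_eMiter (hy : y.support.Finite) (hw : w.support.Finite) (μ : ℤ × ℤ)
    (n k : ℤ) (m : ℕ) :
    pairW (wtZ a1 a2 μ (combine y (eMiter a1 a2 (idx n) m w))) (idx k) =
      pairW (wtZ a1 a2 μ (combine y w)) (idx k) + m * pairJK a1 a2 n k := by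
  induction m with
  | zero => simp [eMiter]
  | succ m ih =>
    have hz := finite_support_eMiter (a1 := a1) (a2 := a2) hw (idx n) m
    obtain ⟨⟨hk, hi, -⟩, -⟩ := isGreatest_kmaxM (a1 := a1) (a2 := a2) hz n
    rw [eMiter, Function.iterate_succ_apply', ← eMiter, eM, combine_update_right hk]
    have := pairW_wtZ_update (a1 := a1) (a2 := a2) (finite_support_combine hy hz) μ
      (kmaxM a1 a2 (eMiter a1 a2 (idx n) m w) (idx n)) (-1) k
    rw [combine, if_neg (by omega)] at this
    rw [sub_eq_add_neg, this, ih, pairJK_congr hi]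
    push_cast
    ring

theorem eZiterO_combine_right (hy : y.support.Finite) (hw : w.support.Finite) (μ : ℤ × ℤ) (n : ℤ)
    (m : ℕ) (h : epsP a1 a2 y (idx n) + m ≤
      phiMf a1 a2 w (idx n) - pairW (wtZ a1 a2 μ (combine y w)) (idx n)) :
    eZiterO a1 a2 μ (idx n) m (some (combine y w)) =
      some (combine y (eMiter a1 a2 (idx n) m w)) := by
  induction m with
  | zero => rfl
  | succ m ih =>
    push_cast at h
    have ih := ih (by omega)
    have h1 := phiMf_eMiter (a1 := a1) (a2 := a2) hw n m
    have h2 := pairW_combine_eMiter (a1 := a1) (a2 := a2) hy hw μ n n m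
    rw [pairJK_of_idx_eq rfl] at h2
    rw [eZiterO, Function.iterate_succ_apply', ← eZiterO, ih, Option.bind_some,
      eZ_combine_right hy (finite_support_eMiter hw _ _) μ n (by omega), eMiter, eMiter,
      Function.iterate_succ_apply']

theorem eZiterO_combine_fPiter (hy : y.support.Finite) (hw : w.support.Finite) (μ : ℤ × ℤ)
    (n : ℤ) (m : ℕ) (h : phiMf a1 a2 w (idx n) - pairW (wtZ a1 a2 μ (combine y w)) (idx n) + m ≤
      epsP a1 a2 y (idx n)) :
    eZiterO a1 a2 μ (idx n) m (some (combine (fPiter a1 a2 (idx n) m y) w)) =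
      some (combine y w) := by
  induction m with
  | zero => rfl
  | succ m ih =>
    push_cast at h
    have ih := ih (by omega)
    have h1 := epsP_fPiter (a1 := a1) (a2 := a2) hy n m
    have h2 := pairW_combine_fPiter (a1 := a1) (a2 := a2) hy hw μ n n (m + 1)
    rw [pairJK_of_idx_eq rfl, fPiter, Function.iterate_succ_apply', ← fPiter] at h2
    push_cast at h2
    rw [eZiterO, Function.iterate_succ_apply, fPiter, Function.iterate_succ_apply', ← fPiter,
      Option.bind_some, eZ_combine_fP (finite_support_fPiter hy _ _) hw μ n (by omega)]
    exact ih

theorem fZiterO_combine_left (hy : y.support.Finite) (hw : w.support.Finite) (μ : ℤ × ℤ) (n : ℤ)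
    (m : ℕ) (h : phiMf a1 a2 w (idx n) - pairW (wtZ a1 a2 μ (combine y w)) (idx n) + m ≤
      epsP a1 a2 y (idx n)) :
    fZiterO a1 a2 μ (idx n) m (some (combine y w)) =
      some (combine (fPiter a1 a2 (idx n) m y) w) := by
  induction m with
  | zero => rfl
  | succ m ih =>
    push_cast at h
    have ih := ih (by omega)
    have h1 := epsP_fPiter (a1 := a1) (a2 := a2) hy n m
    have h2 := pairW_combine_fPiter (a1 := a1) (a2 := a2) hy hw μ n n m
    rw [pairJK_of_idx_eq rfl] at h2
    rw [fZiterO, Function.iterate_succ_apply', ← fZiterO, ih, Option.bind_some,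
      fZ_combine_left (finite_support_fPiter hy _ _) hw μ n (by omega), fPiter, fPiter,
      Function.iterate_succ_apply']

/-- `S_i` on `f̃_i^s y ⊗ t_μ ⊗ w` with `ε_i(y) = 0`, `φ_i(w) = 0` and weight `-(s + t)`. -/
theorem SiO_combine_of_nonpos (hy : y.support.Finite) (hw : w.support.Finite) (μ : ℤ × ℤ) (n : ℤ)
    (s t : ℕ) (hε : epsP a1 a2 y (idx n) = 0) (hφ : phiMf a1 a2 w (idx n) = 0)
    (hwt : pairW (wtZ a1 a2 μ (combine (fPiter a1 a2 (idx n) s y) w)) (idx n) = -((s : ℤ) + t)) :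
    SiO a1 a2 μ (idx n) (some (combine (fPiter a1 a2 (idx n) s y) w)) =
      some (combine y (eMiter a1 a2 (idx n) t w)) := by
  have hys := finite_support_fPiter (a1 := a1) (a2 := a2) hy (idx n) s
  have hwt' := finite_support_eMiter (a1 := a1) (a2 := a2) hw (idx n) t
  have h1 := epsP_fPiter (a1 := a1) (a2 := a2) hy n s
  rw [SiO, Option.bind_some, hwt]
  split_ifs with h
  · obtain ⟨rfl, rfl⟩ : s = 0 ∧ t = 0 := by omega
    rfl
  · have e : (-(-((s : ℤ) + t))).toNat = s + t := by omega
    rw [e, eZiterO, Function.iterate_add_apply, ← eZiterO, ← eZiterO,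
      eZiterO_combine_right hys hw μ n t (by omega)]
    have h2 := phiMf_eMiter (a1 := a1) (a2 := a2) hw n t
    have h3 := pairW_combine_eMiter (a1 := a1) (a2 := a2) hys hw μ n n t
    have h4 := pairW_combine_fPiter (a1 := a1) (a2 := a2) hy hwt' μ n n s
    rw [pairJK_of_idx_eq rfl] at h3 h4
    exact eZiterO_combine_fPiter hy hwt' μ n s (by omega)

theorem SiO_combine_of_nonneg (hy : y.support.Finite) (hw : w.support.Finite) (μ : ℤ × ℤ) (n : ℤ)
    (m : ℕ) (hφ : phiMf a1 a2 w (idx n) = 0)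
    (hwt : pairW (wtZ a1 a2 μ (combine y w)) (idx n) = m) :
    SiO a1 a2 μ (idx n) (some (combine y w)) =
      some (combine (fPiter a1 a2 (idx n) m y) w) := by
  have h0 := epsP_nonneg (a1 := a1) (a2 := a2) hy n
  rw [SiO, Option.bind_some, hwt, if_pos (by omega), Int.toNat_natCast]
  exact fZiterO_combine_left hy hw μ n m (by omega)

/-! ### Strings -/

/-- `f̃_{i_{n+1}}^{x_{n+1}} ⋯ f̃_{i_{n+r}}^{x_{n+r}} (z_∞)`. -/
noncomputable def tailChain (a1 a2 : ℤ) (x : ℤ → ℤ) : ℕ → ℕ → (ℤ → ℤ)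
  | _, 0 => fun _ => 0
  | n, r + 1 =>
    fPiter a1 a2 (idx ((n : ℤ) + 1)) (x ((n : ℤ) + 1)).toNat (tailChain a1 a2 x (n + 1) r)

theorem finite_support_zero : (fun _ => 0 : ℤ → ℤ).support.Finite := by
  simp

theorem finite_support_tailChain (x : ℤ → ℤ) (n r : ℕ) :
    (tailChain a1 a2 x n r).support.Finite := by
  induction r generalizing n with
  | zero => exact finite_support_zero
  | succ r ih => exact finite_support_fPiter (ih _) _ _

theorem tailChain_apply_of_nonpos (x : ℤ → ℤ) (n r : ℕ) {k : ℤ} (hk : k ≤ 0) :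
    tailChain a1 a2 x n r k = 0 := by
  induction r generalizing n with
  | zero => rfl
  | succ r ih =>
    rw [tailChain, fPiter_apply_of_nonpos (finite_support_tailChain _ _ _) _ _ hk, ih]

theorem starPChain_tailChain (x : ℤ → ℤ) (n r : ℕ) :
    starPChain a1 a2 x n (tailChain a1 a2 x n r) = starPChain a1 a2 x (n + r) (fun _ => 0) := by
  induction r generalizing n with
  | zero => rfl
  | succ r ih =>
    rw [tailChain, ← starPChain, ih]
    congr 1
    omega

theorem starPChain_add {N : ℕ} (hN : ∀ k : ℤ, (N : ℤ) < k → x k = 0) (r : ℕ) :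
    starPChain a1 a2 x (N + r) y = starPChain a1 a2 x N y := by
  induction r with
  | zero => rfl
  | succ r ih =>
    rw [← add_assoc, starPChain, hN _ (by push_cast; omega)]
    exact ih

theorem starP_eq_tailChain (hx : ∃ N : ℕ, ∀ k : ℤ, (N : ℤ) < k → x k = 0) {r : ℕ}
    (hr : suppBoundP x ≤ r) : starP a1 a2 x = tailChain a1 a2 x 0 r := by
  have hN : ∀ k : ℤ, (suppBoundP x : ℤ) < k → x k = 0 := Nat.sInf_mem hx
  have h := starPChain_tailChain (a1 := a1) (a2 := a2) x 0 r
  obtain ⟨s, rfl⟩ := Nat.exists_eq_add_of_le hr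
  rw [zero_add, starPChain_add hN] at h
  exact h.symm

theorem coneBound_tailChain (h1 : 1 ≤ a1) (h2 : 1 ≤ a2) (ha : 4 < a1 * a2) {N : ℕ}
    (hN : ∀ k : ℤ, (N : ℤ) < k → x k = 0) (hx0 : ∀ k, 0 ≤ x k)
    (hx : ∀ k : ℤ, 1 ≤ k → (x (k + 1) : ℝ) ≤ gammaR a1 a2 k * x k) (n r : ℕ) (hr : N ≤ n + r) :
    ConeBound a1 a2 (n + 1) (x (n + 1)) (tailChain a1 a2 x n r) := by
  induction r generalizing n with
  | zero =>
    rw [hN _ (by omega)]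
    exact coneBound_zero _
  | succ r ih =>
    have ih := ih (n + 1) (by omega)
    have hc : ((x ((n : ℤ) + 1)).toNat : ℤ) = x (n + 1) := Int.toNat_of_nonneg (hx0 _)
    have := ih.fPiter (n' := n + 1) (m' := (x ((n : ℤ) + 1)).toNat) h1 h2 ha
      (finite_support_tailChain _ _ _) (by rw [idx_ne_iff]; push_cast; omega) (by
        have h3 := hx (n + 1) (by omega)
        have hc' : (((x ((n : ℤ) + 1)).toNat : ℕ) : ℝ) = x (n + 1) := by exact_mod_cast hc
        rw [hc']
        push_cast
        exact h3)
    rw [hc] at this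
    exact this

theorem finite_support_eMposChain (g : ℤ → ℕ) (n : ℕ) :
    (eMposChain a1 a2 g n (fun _ => 0)).support.Finite := by
  induction n with
  | zero => exact finite_support_zero
  | succ n ih => exact finite_support_eMiter ih _ _

theorem coneBound_mirror_eMposChain (h1 : 1 ≤ a1) (h2 : 1 ≤ a2) (ha : 4 < a1 * a2) {g : ℤ → ℕ}
    (hg : ∀ k : ℤ, 1 ≤ k → (g k : ℝ) ≤ gammaR a1 a2 (k + 1) * g (k + 1)) (n : ℕ) :
    ConeBound a2 a1 (1 - n) (if n = 0 then 0 else g n)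
      (mirror (eMposChain a1 a2 g n (fun _ => 0))) := by
  induction n with
  | zero =>
    have : mirror (fun _ => 0) = fun _ => 0 := by ext; simp [mirror]
    rw [if_pos rfl, eMposChain, this]
    exact coneBound_zero _
  | succ n ih =>
    have hf := finite_support_eMposChain (a1 := a1) (a2 := a2) g n
    rw [eMposChain, mirror_eMiter hf, if_neg (by omega)]
    have hγ := gammaR_swap (a1 := a1) (a2 := a2) ((n : ℤ) + 1)
    have := ih.fPiter (n' := 1 - ((n : ℤ) + 1)) (m' := g ((n : ℤ) + 1)) h2 h1
      (by rwa [mul_comm]) (finite_support_mirror hf) (by rw [idx_ne_iff]; omega) (by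
        rw [hγ]
        split_ifs with h0
        · have := gammaR_pos h1 h2 ((n : ℤ) + 1)
          push_cast
          positivity
        · exact_mod_cast hg n (by omega))
    push_cast
    exact this

theorem phiMf_eMposChain (h1 : 1 ≤ a1) (h2 : 1 ≤ a2) (ha : 4 < a1 * a2) {g : ℤ → ℕ}
    (hg : ∀ k : ℤ, 1 ≤ k → (g k : ℝ) ≤ gammaR a1 a2 (k + 1) * g (k + 1)) (n : ℕ) :
    phiMf a1 a2 (eMposChain a1 a2 g n (fun _ => 0)) (idx ((n : ℤ) + 1)) = 0 := by
  rw [phiMf_eq]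
  exact (coneBound_mirror_eMposChain h1 h2 ha hg n).epsP_eq_zero h2 h1
    (finite_support_mirror (finite_support_eMposChain g n)) (by rw [idx_ne_iff]; omega)

theorem phiMf_zero (n : ℤ) : phiMf a1 a2 (fun _ => 0) (idx n) = 0 := by
  obtain ⟨-, -, hs⟩ := (isGreatest_kmaxM (a1 := a1) (a2 := a2) finite_support_zero n).1
  rw [← hs]
  simp [sigmaM]

theorem combine_zero_right (hy : ∀ k ≤ 0, y k = 0) : combine y (fun _ => 0) = y := by
  ext k
  rw [combine]
  split_ifs with h
  · rfl
  · exact (hy k (by omega)).symm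

theorem pairW_wtOf_fPiter (hy : y.support.Finite) (hy0 : ∀ k ≤ 0, y k = 0) (n k : ℤ) (m : ℕ) :
    pairW (wtOf a1 a2 (fPiter a1 a2 (idx n) m y)) (idx k) =
      pairW (wtOf a1 a2 y) (idx k) - m * pairJK a1 a2 n k := by
  have h := pairW_combine_fPiter (a1 := a1) (a2 := a2) hy finite_support_zero 0 n k m
  rw [combine_zero_right hy0, combine_zero_right
    (fun l hl => (fPiter_apply_of_nonpos hy n m hl).trans (hy0 l hl))] at h
  simpa [wtZ] using h

theorem pairW_wtOf_tailChain (hx0 : ∀ k, 0 ≤ x k) (k : ℤ) (n r : ℕ) :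
    pairW (wtOf a1 a2 (tailChain a1 a2 x n r)) (idx k) =
      pairW (wtOf a1 a2 (fun l => if (n : ℤ) < l ∧ l ≤ n + r then x l else 0)) (idx k) := by
  induction r generalizing n with
  | zero =>
    have : (fun l : ℤ => if (n : ℤ) < l ∧ l ≤ n + (0 : ℕ) then x l else 0) = fun _ => 0 := by
      funext l
      rw [if_neg (by push_cast; omega)]
    rw [this]
    rfl
  | succ r ih =>
    rw [tailChain, pairW_wtOf_fPiter (finite_support_tailChain x (n + 1) r)
      (fun l hl => tailChain_apply_of_nonpos x (n + 1) r hl), ih]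
    set z : ℤ → ℤ := fun l => if ((n + 1 : ℕ) : ℤ) < l ∧ l ≤ (n + 1 : ℕ) + r then x l else 0 with hz
    have hfin : z.support.Finite := by
      refine (Set.finite_Icc (0 : ℤ) (n + 1 + r)).subset fun l hl => ?_
      have : ((n + 1 : ℕ) : ℤ) < l ∧ l ≤ (n + 1 : ℕ) + r := by
        by_contra h
        exact hl (if_neg h)
      push_cast at this
      simp only [Set.mem_Icc]
      omega
    have hupd : (fun l : ℤ => if (n : ℤ) < l ∧ l ≤ n + (r + 1 : ℕ) then x l else 0) =
        Function.update z (n + 1) (z (n + 1) + x (n + 1)) := by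
      funext l
      by_cases hl : l = n + 1
      · subst hl
        simp [hz]
      · rw [Function.update_of_ne hl, hz]
        refine if_congr ?_ rfl rfl
        push_cast
        omega
    rw [hupd, pairW_wtOf_update hfin, Int.toNat_of_nonneg (hx0 _)]
    ring

theorem pairW_wtOf_starP (hx : ZPlusMem x) (k : ℤ) :
    pairW (wtOf a1 a2 (starP a1 a2 x)) (idx k) = pairW (wtOf a1 a2 x) (idx k) := by
  obtain ⟨hneg, hx0, hN⟩ := hx
  have hsupp : ∀ k : ℤ, (suppBoundP x : ℤ) < k → x k = 0 := Nat.sInf_mem hN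
  rw [starP_eq_tailChain hN le_rfl, pairW_wtOf_tailChain hx0]
  congr 2
  funext l
  split_ifs with h
  · rfl
  · rcases le_or_gt l 0 with hl | hl
    · exact (hneg l hl).symm
    · exact (hsupp l (by push_cast at h; omega)).symm

theorem starM_zero : starM a1 a2 (fun _ => 0) = fun _ => 0 := by
  have (n : ℕ) (z : ℤ → ℤ) : starMChain a1 a2 (fun _ => 0) n z = z := by
    induction n generalizing z with
    | zero => rfl
    | succ n ih => simpa [starMChain, eMiter] using ih z
  exact this _ _

theorem posPart_eq_self (hx : ∀ k ≤ 0, x k = 0) : HypCrystal.posPart x = x := by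
  funext k
  rw [HypCrystal.posPart]
  split_ifs with h
  · rfl
  · exact (hx k (by omega)).symm

theorem negPart_eq_zero (hx : ∀ k ≤ 0, x k = 0) : HypCrystal.negPart x = fun _ => 0 := by
  funext k
  rw [HypCrystal.negPart]
  split_ifs with h
  · exact hx k h
  · rfl

theorem xstarFun_eq (hx : ∀ k ≤ 0, x k = 0) :
    xstarFun a1 a2 x = combine (starP a1 a2 x) (fun _ => 0) := by
  rw [xstarFun, posPart_eq_self hx, negPart_eq_zero hx, starM_zero]

theorem finite_support_starP (hx : ZPlusMem x) : (starP a1 a2 x).support.Finite := by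
  rw [starP_eq_tailChain hx.2.2 le_rfl]
  exact finite_support_tailChain x 0 _

theorem pairW_wtZ_mustar (hx : ZPlusMem x) (lam : ℤ × ℤ) (k : ℤ) :
    pairW (wtZ a1 a2 (mustar a1 a2 lam x) (combine (starP a1 a2 x) (fun _ => 0))) (idx k) =
      -pairW lam (idx k) := by
  have h := pairW_wtOf_starP (a1 := a1) (a2 := a2) hx k
  have hs : ∀ l ≤ 0, starP a1 a2 x l = 0 := by
    rw [starP_eq_tailChain hx.2.2 le_rfl]
    exact fun l hl => tailChain_apply_of_nonpos x 0 _ hl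
  rw [combine_zero_right hs, wtZ, pairW_add, h, ← pairW_add, mustar, posPart_eq_self hx.1,
    negPart_eq_zero hx.1]
  have h0 : wtOf a1 a2 (fun _ => 0) = 0 := by simp [wtOf]
  rw [h0, sub_zero, sub_add_cancel]
  simp only [pairW]
  split_ifs <;> rfl

theorem aIdx_congr {k l : ℤ} (h : idx k = idx l) : aIdx a1 a2 k = aIdx a1 a2 l := by
  rw [idx_eq_iff] at h
  rw [aIdx, aIdx, h]

theorem SwPos_combine_tailChain (h1 : 1 ≤ a1) (h2 : 1 ≤ a2) (ha : 4 < a1 * a2) {k1 k2 : ℤ}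
    {μ : ℤ × ℤ} (hx0 : ZPlusMem x)
    (hxp : ∀ k : ℤ, 1 ≤ k → x k ≤ pseq a1 a2 k1 k2 k)
    (hxγ : ∀ k : ℤ, 1 ≤ k → (x (k + 1) : ℝ) ≤ gammaR a1 a2 k * x k)
    (hpγ : ∀ k : ℤ, 1 ≤ k → (pseq a1 a2 k1 k2 k : ℝ) - x k ≤
      gammaR a1 a2 (k + 1) * (pseq a1 a2 k1 k2 (k + 1) - x (k + 1)))
    (hwt0 : pairW (wtZ a1 a2 μ (combine (starP a1 a2 x) (fun _ => 0))) (idx 0) =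
      pseq a1 a2 k1 k2 0)
    (hwt1 : pairW (wtZ a1 a2 μ (combine (starP a1 a2 x) (fun _ => 0))) (idx 1) =
      -pseq a1 a2 k1 k2 1)
    (n r : ℕ) (hr : suppBoundP x ≤ n + r) :
    ePposChainO a1 a2 (fun m => (x m).toNat) n (some (starP a1 a2 x)) =
        some (tailChain a1 a2 x n r) ∧
      SwPos a1 a2 μ n (some (combine (starP a1 a2 x) (fun _ => 0))) =
        some (combine (tailChain a1 a2 x n r)
          (eMposChain a1 a2 (fun m => (pseq a1 a2 k1 k2 m - x m).toNat) n (fun _ => 0))) ∧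
      pairW (wtZ a1 a2 μ (combine (tailChain a1 a2 x n r)
          (eMposChain a1 a2 (fun m => (pseq a1 a2 k1 k2 m - x m).toNat) n (fun _ => 0))))
        (idx n) = pseq a1 a2 k1 k2 n ∧
      pairW (wtZ a1 a2 μ (combine (tailChain a1 a2 x n r)
          (eMposChain a1 a2 (fun m => (pseq a1 a2 k1 k2 m - x m).toNat) n (fun _ => 0))))
        (idx (n + 1)) = -pseq a1 a2 k1 k2 (n + 1) := by
  have hsupp : ∀ k : ℤ, (suppBoundP x : ℤ) < k → x k = 0 := Nat.sInf_mem hx0.2.2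
  set g : ℤ → ℕ := fun m => (pseq a1 a2 k1 k2 m - x m).toNat with hgdef
  have hgval (k : ℤ) (hk : 1 ≤ k) : (g k : ℤ) = pseq a1 a2 k1 k2 k - x k :=
    Int.toNat_of_nonneg (sub_nonneg.2 (hxp k hk))
  have hgR (k : ℤ) (hk : 1 ≤ k) : (g k : ℝ) = pseq a1 a2 k1 k2 k - x k := by
    exact_mod_cast hgval k hk
  have hg (k : ℤ) (hk : 1 ≤ k) : (g k : ℝ) ≤ gammaR a1 a2 (k + 1) * g (k + 1) := by
    rw [hgR k hk, hgR (k + 1) (by omega)]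
    exact hpγ k hk
  induction n generalizing r with
  | zero =>
    rw [← starP_eq_tailChain hx0.2.2 (by omega)]
    exact ⟨rfl, rfl, by simpa [eMposChain] using hwt0, by simpa [eMposChain] using hwt1⟩
  | succ n ih =>
    obtain ⟨he, hS, hw0, hw1⟩ := ih (r + 1) (by omega)
    have hy := finite_support_tailChain (a1 := a1) (a2 := a2) x (n + 1) r
    have hw := finite_support_eMposChain (a1 := a1) (a2 := a2) g n
    have hne : idx ((n : ℤ) + 1) ≠ idx (((n + 1 : ℕ) : ℤ) + 1) := by
      rw [idx_ne_iff]
      push_cast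
      omega
    have hxval : (((x (n + 1)).toNat : ℕ) : ℤ) = x (n + 1) := Int.toNat_of_nonneg (hx0.2.1 _)
    have hgn := hgval (n + 1) (by omega)
    rw [tailChain] at he hS hw0 hw1
    have hε := (coneBound_tailChain h1 h2 ha hsupp hx0.2.1 hxγ (n + 1) r hr).epsP_eq_zero h1 h2 hy
      hne
    have hweight (k : ℤ) := pairW_combine_fPiter (a1 := a1) (a2 := a2) hy hw μ (n + 1) k
      (x (n + 1)).toNat
    have hweight' (k : ℤ) := pairW_combine_eMiter (a1 := a1) (a2 := a2) hy hw μ (n + 1) k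
      (g (n + 1))
    refine ⟨?_, ?_, ?_, ?_⟩
    · rw [ePposChainO, he]
      exact ePiterO_fPiter hy _ _
    · rw [SwPos, hS]
      refine SiO_combine_of_nonpos hy hw μ _ _ _ hε (phiMf_eMposChain h1 h2 ha hg n) ?_
      rw [hw1, hxval, hgn]
      ring
    · have e1 := hweight (n + 1)
      have e2 := hweight' (n + 1)
      rw [pairJK_of_idx_eq rfl] at e1 e2
      rw [hw1, hxval] at e1
      rw [hgn] at e2
      rw [eMposChain]
      push_cast
      linarith
    · have hidx : idx ((n : ℤ) + 1 + 1) = idx n := by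
        rw [idx_eq_iff]
        omega
      have hne' : idx ((n : ℤ) + 1) ≠ idx (n : ℤ) := by
        rw [idx_ne_iff]
        omega
      have e1 := hweight n
      have e2 := hweight' n
      have e3 := pseq_rec (a1 := a1) (a2 := a2) k1 k2 n
      rw [pairJK_of_idx_ne hne'] at e1 e2
      rw [hw0, hxval] at e1
      rw [hgn] at e2
      rw [eMposChain]
      push_cast
      rw [hidx, show (n : ℤ) + 1 + 1 = n + 2 by ring]
      linarith

theorem finite_support_fPnegChain (hy : y.support.Finite) (g : ℤ → ℕ) (n : ℕ) :
    (fPnegChain a1 a2 g n y).support.Finite := by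
  induction n with
  | zero => exact hy
  | succ n ih => exact finite_support_fPiter ih _ _

theorem SwNeg_combine_fPnegChain {k1 k2 : ℤ} {μ : ℤ × ℤ} (hy : y.support.Finite)
    (hp : ∀ k : ℤ, k ≤ 0 → 0 ≤ pseq a1 a2 k1 k2 k)
    (hwt0 : pairW (wtZ a1 a2 μ (combine y (fun _ => 0))) (idx 0) = pseq a1 a2 k1 k2 0)
    (hwt1 : pairW (wtZ a1 a2 μ (combine y (fun _ => 0))) (idx 1) = -pseq a1 a2 k1 k2 1)
    (n : ℕ) :
    SwNeg a1 a2 μ n (some (combine y (fun _ => 0))) =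
        some (combine (fPnegChain a1 a2 (fun m => (pseq a1 a2 k1 k2 m).toNat) n y)
          (fun _ => 0)) ∧
      pairW (wtZ a1 a2 μ (combine
          (fPnegChain a1 a2 (fun m => (pseq a1 a2 k1 k2 m).toNat) n y) (fun _ => 0)))
        (idx (-n)) = pseq a1 a2 k1 k2 (-n) ∧
      pairW (wtZ a1 a2 μ (combine
          (fPnegChain a1 a2 (fun m => (pseq a1 a2 k1 k2 m).toNat) n y) (fun _ => 0)))
        (idx (1 - n)) = -pseq a1 a2 k1 k2 (1 - n) := by
  induction n with
  | zero => exact ⟨rfl, by simpa [fPnegChain] using hwt0, by simpa [fPnegChain] using hwt1⟩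
  | succ n ih =>
    obtain ⟨hS, hw0, hw1⟩ := ih
    have hpn : (((pseq a1 a2 k1 k2 (-n)).toNat : ℕ) : ℤ) = pseq a1 a2 k1 k2 (-n) :=
      Int.toNat_of_nonneg (hp _ (by omega))
    have hfin := finite_support_fPnegChain (a1 := a1) (a2 := a2) hy
      (fun m => (pseq a1 a2 k1 k2 m).toNat) n
    have hweight (k : ℤ) := pairW_combine_fPiter (a1 := a1) (a2 := a2) hfin finite_support_zero μ
      (-n) k (pseq a1 a2 k1 k2 (-n)).toNat
    refine ⟨?_, ?_, ?_⟩
    · rw [SwNeg, hS]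
      exact SiO_combine_of_nonneg hfin finite_support_zero μ _ _ (phiMf_zero _) (hw0.trans hpn.symm)
    · have hidx : idx (-((n + 1 : ℕ) : ℤ)) = idx (1 - (n : ℤ)) := by
        rw [idx_eq_iff]
        push_cast
        omega
      have hne : idx (-(n : ℤ)) ≠ idx (1 - (n : ℤ)) := by
        rw [idx_ne_iff]
        omega
      have e1 := hweight (1 - n)
      have e2 := pseq_rec (a1 := a1) (a2 := a2) k1 k2 (-(n : ℤ) - 1)
      rw [pairJK_of_idx_ne hne, hw1, hpn] at e1
      rw [show -(n : ℤ) - 1 + 2 = 1 - n by ring, sub_add_cancel,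
        aIdx_congr (l := 1 - n) (by rw [idx_eq_iff]; omega)] at e2
      rw [fPnegChain, hidx]
      push_cast
      rw [show -((n : ℤ) + 1) = -(n : ℤ) - 1 by ring]
      linarith
    · have e1 := hweight (-n)
      rw [pairJK_of_idx_eq rfl, hw0, hpn] at e1
      rw [fPnegChain]
      push_cast
      rw [show (1 : ℤ) - (n + 1) = -n by ring]
      linarith
end Crystal
end HypCrystal

open HypCrystal in
theorem Swk_on_sigmaPrime
    (a1 a2 : ℤ) (ha1 : 1 ≤ a1) (ha2 : 1 ≤ a2) (ha : 4 < a1 * a2)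
    (k1 k2 : ℤ) (hk1 : 0 < k1) (hk2 : 0 < k2)
    (hreg : 2 ≤ a1 → 2 ≤ a2 →
      (k2 ≤ k1 ∧ k1 < (a1 - 1) * k2) ∨ (k1 < k2 ∧ k2 ≤ (a2 - 1) * k1))
    (hdeg1 : a1 = 1 → 2 * k1 ≤ k2 ∧ k2 ≤ (a2 - 2) * k1)
    (hdeg2 : a2 = 1 → 2 * k2 ≤ k1 ∧ k1 ≤ (a1 - 2) * k2)
    (x : ℤ → ℤ) (hx : SigmaPrimeMem a1 a2 k1 k2 x) :
    (∀ k : ℤ, 0 ≤ k →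
      ∃ y : ℤ → ℤ,
        ePposChainO a1 a2 (fun m => (x m).toNat) k.toNat
            (some (starP a1 a2 (HypCrystal.posPart x))) = some y ∧
        Swk a1 a2 (mustar a1 a2 (lamW k1 k2) x) k (some (xstarFun a1 a2 x)) =
          some (combine y
            (eMposChain a1 a2 (fun m => (pseq a1 a2 k1 k2 m - x m).toNat) k.toNat
              (fun _ => 0)))) ∧
    (∀ k : ℤ, k ≤ 0 →
      Swk a1 a2 (mustar a1 a2 (lamW k1 k2) x) k (some (xstarFun a1 a2 x)) =
        some (combine
          (fPnegChain a1 a2 (fun m => (pseq a1 a2 k1 k2 m).toNat) (-k).toNat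
            (starP a1 a2 (HypCrystal.posPart x)))
          (fun _ => 0))) := by
  obtain ⟨⟨hmem, -, -, hxp, hxγ, hpγ, hp, -⟩, hx0, -⟩ := hx
  have hpos := posPart_eq_self hx0
  have hZ : ZPlusMem x := hpos ▸ hmem.1
  have hwt0 := pairW_wtZ_mustar (a1 := a1) (a2 := a2) hZ (lamW k1 k2) 0
  have hwt1 := pairW_wtZ_mustar (a1 := a1) (a2 := a2) hZ (lamW k1 k2) 1
  replace hwt0 : _ = pseq a1 a2 k1 k2 0 := hwt0.trans (by simp [pairW, idx, lamW, pseq, ppos])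
  replace hwt1 : _ = -pseq a1 a2 k1 k2 1 := hwt1.trans (by simp [pairW, idx, lamW, pseq, ppos])
  rw [xstarFun_eq hx0, hpos]
  constructor
  · intro k hk
    obtain ⟨he, hS, -⟩ := SwPos_combine_tailChain ha1 ha2 ha hZ
      (fun m hm => by exact_mod_cast sub_nonneg.1 (hxp m hm))
      (fun m hm => sub_nonneg.1 (hxγ m hm))
      (fun m hm => by linarith [hpγ m hm]) hwt0 hwt1 k.toNat (suppBoundP x) (by omega)
    exact ⟨_, he, by rw [Swk, if_pos hk, hS]⟩
  · intro k hk
    have hS := (SwNeg_combine_fPnegChain (finite_support_starP hZ)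
      (fun m hm => by simpa [hx0 m hm] using hp m hm) hwt0 hwt1 (-k).toNat).1
    rw [Swk]
    split_ifs with h
    · obtain rfl : k = 0 := le_antisymm hk h
      exact hS
    · exact hS
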